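/- arXiv:2407.18577 — 3 statements merged into one kernel-verified Lean document; each statement's English description precedes it below -/
import Mathlib

section
/- Let p, q ≥ 1 and let Ω be a proper quasi-homogeneous domain of Ein^{p,q}. Then the Markowitz distance δ^Ω is a proper metric on Ω: for every x ∈ Ω and every r ≥ 0, the set {y ∈ Ω : δ^Ω(x, y) ≤ r} is compact. -/
noncomputable section

open scoped LinearAlgebra.Projectivization ENNReal
open Projectivization Filter Topology Set

variable {W : Type} [AddCommGroup W] [Module ℝ W] [TopologicalSpace W]

instance projTopology : TopologicalSpace (ℙ ℝ W) :=
  inferInstanceAs (TopologicalSpace (Quotient (projectivizationSetoid ℝ W)))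

/-- The null cone in projective space determined by a quadratic form `v ↦ Bf v v`. -/
def einSet (Bf : W → W → ℝ) : Set (ℙ ℝ W) := {x | Bf x.rep x.rep = 0}

/-- The lightcone of a point of the Einstein universe. -/
def lightcone (Bf : W → W → ℝ) (x : ℙ ℝ W) : Set (ℙ ℝ W) :=
  {y | y ∈ einSet Bf ∧ Bf x.rep y.rep = 0}

/-- A domain: nonempty connected open subset of the Einstein universe
(open and connected in the subspace topology of `einSet Bf`). -/
def IsEinDomain (Bf : W → W → ℝ) (Ω : Set (ℙ ℝ W)) : Prop :=
  Ω ⊆ einSet Bf ∧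
  IsOpen (Subtype.val ⁻¹' Ω : Set (einSet Bf)) ∧
  IsConnected (Subtype.val ⁻¹' Ω : Set (einSet Bf))

/-- A proper domain: some lightcone misses the closure. -/
def IsProperDomain (Bf : W → W → ℝ) (Ω : Set (ℙ ℝ W)) : Prop :=
  IsEinDomain Bf Ω ∧ ∃ x ∈ einSet Bf, closure Ω ∩ lightcone Bf x = ∅

/-- The projective transformation induced by a linear automorphism. -/
def projMap (g : W ≃ₗ[ℝ] W) : ℙ ℝ W → ℙ ℝ W :=
  Projectivization.map (g : W →ₗ[ℝ] W) g.injective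

/-- The conformal group of a domain. -/
def Conf (Bf : W → W → ℝ) (Ω : Set (ℙ ℝ W)) : Set (W ≃ₗ[ℝ] W) :=
  {g | (∀ v, Bf (g v) (g v) = Bf v v) ∧ projMap g '' Ω = Ω}

/-- Quasi-homogeneity of a domain. -/
def IsQuasiHomogeneous (Bf : W → W → ℝ) (Ω : Set (ℙ ℝ W)) : Prop :=
  ∃ K : Set (ℙ ℝ W), K ⊆ Ω ∧ IsCompact K ∧
    Ω = ⋃ g ∈ Conf Bf Ω, projMap g '' K

/-- Dual convexity: every frontier point admits a supporting lightcone. -/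
def IsDuallyConvex (Bf : W → W → ℝ) (Ω : Set (ℙ ℝ W)) : Prop :=
  ∀ a ∈ closure Ω \ Ω, ∃ b ∈ einSet Bf, a ∈ lightcone Bf b ∧ lightcone Bf b ∩ Ω = ∅

/-- The hyperbolic distance on the interval `(-1,1)`. -/
def dHyp (s t : ℝ) : ℝ := |Real.log (((1 + t) * (1 - s)) / ((1 - t) * (1 + s)))|

/-- The interval of parameters. -/
def II : Set ℝ := Set.Ioo (-1 : ℝ) 1

/-- A projectively parametrized lightlike geodesic with values in `Ω`. -/
def IsLightGeodesic (Bf : W → W → ℝ) (Ω : Set (ℙ ℝ W)) (α : ℝ → ℙ ℝ W) : Prop :=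
  ∃ (u w : W) (a b c d : ℝ),
    LinearIndependent ℝ ![u, w] ∧
    Bf u u = 0 ∧ Bf u w = 0 ∧ Bf w w = 0 ∧
    a * d - b * c ≠ 0 ∧
    ∀ t ∈ II, ∃ h : (a * t + b) • u + (c * t + d) • w ≠ 0,
      α t = Projectivization.mk ℝ ((a * t + b) • u + (c * t + d) • w) h ∧ α t ∈ Ω

/-- `IsChainCost Bf Ω x y N c` : there is a chain of index `N` from `x` to `y` in `Ω`
whose cost is `c`. -/
def IsChainCost (Bf : W → W → ℝ) (Ω : Set (ℙ ℝ W)) (x y : ℙ ℝ W) (N : ℕ) (c : ℝ) : Prop :=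
  ∃ (xs : Fin (N + 1) → ℙ ℝ W) (αs : Fin N → ℝ → ℙ ℝ W) (ss ts : Fin N → ℝ),
    xs 0 = x ∧ xs (Fin.last N) = y ∧
    (∀ i : Fin N, IsLightGeodesic Bf Ω (αs i) ∧ ss i ∈ II ∧ ts i ∈ II ∧
      αs i (ss i) = xs i.castSucc ∧ αs i (ts i) = xs i.succ) ∧
    c = ∑ i : Fin N, dHyp (ss i) (ts i)

/-- The Markowitz pseudodistance of `Ω`, with values in `[0,∞]`. -/
def markowitz (Bf : W → W → ℝ) (Ω : Set (ℙ ℝ W)) (x y : ℙ ℝ W) : ℝ≥0∞ :=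
  sInf {e | ∃ (N : ℕ) (c : ℝ), 1 ≤ N ∧ IsChainCost Bf Ω x y N c ∧ e = ENNReal.ofReal c}

/-- The Markowitz pseudodistance restricted to chains of index at most `Nmax`. -/
def markowitzN (Bf : W → W → ℝ) (Ω : Set (ℙ ℝ W)) (Nmax : ℕ) (x y : ℙ ℝ W) : ℝ≥0∞ :=
  sInf {e | ∃ (N : ℕ) (c : ℝ), 1 ≤ N ∧ N ≤ Nmax ∧ IsChainCost Bf Ω x y N c ∧
    e = ENNReal.ofReal c}

/-- The projectivization of a linear subspace. -/
def projSet (Pl : Submodule ℝ W) : Set (ℙ ℝ W) := {y | y.rep ∈ Pl}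

/-- A photon subspace: a totally isotropic plane. -/
def IsPhotonSub (Bf : W → W → ℝ) (Pl : Submodule ℝ W) : Prop :=
  Module.finrank ℝ Pl = 2 ∧ ∀ u ∈ Pl, ∀ w ∈ Pl, Bf u w = 0

/-- Photon-extremal points of the frontier of `Ω`. -/
def IsPhotonExtremal (Bf : W → W → ℝ) (Ω : Set (ℙ ℝ W)) (a : ℙ ℝ W) : Prop :=
  a ∈ closure Ω \ Ω ∧
  ∀ Pl : Submodule ℝ W, IsPhotonSub Bf Pl → a.rep ∈ Pl →
    ¬ ∃ U : Set (ℙ ℝ W), IsOpen U ∧ a ∈ U ∧ U ∩ projSet Pl ⊆ closure Ω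

/-- A maximal projectively parametrized lightlike geodesic in `Ω`: its image is
a connected component of `ℙ(Pl) ∩ Ω`. -/
def IsMaxLightGeodesic (Bf : W → W → ℝ) (Ω : Set (ℙ ℝ W)) (α : ℝ → ℙ ℝ W) : Prop :=
  ∃ (u w : W) (a b c d : ℝ),
    LinearIndependent ℝ ![u, w] ∧
    Bf u u = 0 ∧ Bf u w = 0 ∧ Bf w w = 0 ∧
    a * d - b * c ≠ 0 ∧
    (∀ t ∈ II, ∃ h : (a * t + b) • u + (c * t + d) • w ≠ 0,
      α t = Projectivization.mk ℝ ((a * t + b) • u + (c * t + d) • w) h ∧ α t ∈ Ω) ∧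
    α '' II = connectedComponentIn (projSet (Submodule.span ℝ {u, w}) ∩ Ω) (α 0)

/-- The coordinate bilinear form of signature `(p+1, q+1)` on `ℝⁿ`, `n = p+q+2`. -/
def bForm (p q : ℕ) (v w : Fin (p + q + 2) → ℝ) : ℝ :=
  ∑ i : Fin (p + q + 2), (if (i : ℕ) ≤ p then (-1 : ℝ) else 1) * v i * w i

section MarkowitzProper

variable {p q : ℕ}

local notation "EE" => (Fin (p + q + 2) → ℝ)

lemma bF_add_left (u v w : EE) : bForm p q (u + v) w = bForm p q u w + bForm p q v w := by
  simp only [bForm, ← Finset.sum_add_distrib, Pi.add_apply]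
  exact Finset.sum_congr rfl fun i _ => by ring

lemma bF_smul_left (a : ℝ) (v w : EE) : bForm p q (a • v) w = a * bForm p q v w := by
  simp only [bForm, Finset.mul_sum, Pi.smul_apply, smul_eq_mul]
  exact Finset.sum_congr rfl fun i _ => by ring

lemma bF_comm (v w : EE) : bForm p q v w = bForm p q w v := by
  simp only [bForm]
  exact Finset.sum_congr rfl fun i _ => by ring

lemma bF_add_right (u v w : EE) : bForm p q w (u + v) = bForm p q w u + bForm p q w v := by
  rw [bF_comm, bF_add_left, bF_comm u, bF_comm v]

lemma bF_smul_right (a : ℝ) (v w : EE) : bForm p q w (a • v) = a * bForm p q w v := by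
  rw [bF_comm, bF_smul_left, bF_comm]

lemma bF_neg_left (v w : EE) : bForm p q (-v) w = - bForm p q v w := by
  rw [← neg_one_smul ℝ, bF_smul_left]; ring

lemma bF_neg_right (v w : EE) : bForm p q w (-v) = - bForm p q w v := by
  rw [← neg_one_smul ℝ, bF_smul_right]; ring

lemma bF_sub_left (u v w : EE) : bForm p q (u - v) w = bForm p q u w - bForm p q v w := by
  rw [sub_eq_add_neg, bF_add_left, bF_neg_left]; ring

lemma bF_sub_right (u v w : EE) : bForm p q w (u - v) = bForm p q w u - bForm p q w v := by
  rw [sub_eq_add_neg, bF_add_right, bF_neg_right]; ring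

lemma bF_zero_right (w : EE) : bForm p q w 0 = 0 := by simp [bForm]

lemma bF_zero_left (w : EE) : bForm p q 0 w = 0 := by simp [bForm]

lemma bF_cont {X : Type*} [TopologicalSpace X] {f g : X → EE} (hf : Continuous f)
    (hg : Continuous g) : Continuous fun x => bForm p q (f x) (g x) := by
  unfold bForm; fun_prop

/-- A two-dimensional coordinate plane meets every hyperplane. -/
lemma exists_pair (x y : ℝ) : ∃ a b : ℝ, a * x + b * y = 0 ∧ 0 < a * a + b * b := by
  by_cases h : x = 0
  · exact ⟨1, 0, by simp [h], by norm_num⟩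
  · exact ⟨-y, x, by ring, by have := mul_self_pos.mpr h; nlinarith [mul_self_nonneg y]⟩

lemma bF_single (i : Fin (p + q + 2)) (w : EE) :
    bForm p q (Pi.single i 1) w = (if (i : ℕ) ≤ p then (-1 : ℝ) else 1) * w i := by
  unfold bForm
  rw [Finset.sum_eq_single i]
  · simp
  · intro j _ hj; simp [hj]
  · simp

lemma exists_neg (hp : 1 ≤ p) (n : EE) : ∃ f : EE, bForm p q f n = 0 ∧ bForm p q f f < 0 := by
  let i0 : Fin (p + q + 2) := ⟨0, by omega⟩
  let i1 : Fin (p + q + 2) := ⟨1, by omega⟩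
  obtain ⟨a, b, h, h'⟩ := exists_pair (n i0) (n i1)
  have hne : i0 ≠ i1 := by simp [i0, i1]
  refine ⟨a • Pi.single i0 1 + b • Pi.single i1 1, ?_, ?_⟩
  · simp only [bF_add_left, bF_smul_left, bF_single]
    simp only [i0, i1, zero_le, hp, if_true]
    simp only [i0, i1] at h
    linarith
  · simp only [bF_add_left, bF_smul_left, bF_single]
    simp [hne, hne.symm]
    simp only [i0, i1, zero_le, hp, if_true]
    linarith

lemma exists_pos (hq : 1 ≤ q) (n : EE) : ∃ f : EE, bForm p q f n = 0 ∧ 0 < bForm p q f f := by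
  let i0 : Fin (p + q + 2) := ⟨p + 1, by omega⟩
  let i1 : Fin (p + q + 2) := ⟨p + 2, by omega⟩
  obtain ⟨a, b, h, h'⟩ := exists_pair (n i0) (n i1)
  have hne : i0 ≠ i1 := by simp [i0, i1]
  have e0 : ¬ ((i0 : ℕ) ≤ p) := by simp [i0]
  have e1 : ¬ ((i1 : ℕ) ≤ p) := by simp [i1]
  refine ⟨a • Pi.single i0 1 + b • Pi.single i1 1, ?_, ?_⟩
  · simp only [bF_add_left, bF_smul_left, bF_single, e0, e1, if_false]
    linarith
  · simp only [bF_add_left, bF_smul_left, bF_single, e0, e1, if_false]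
    simp [hne, hne.symm]
    linarith

/-- In the orthogonal of a hyperbolic pair there is another hyperbolic pair. -/
lemma exists_hyp (hp : 1 ≤ p) (hq : 1 ≤ q) (v0 v : EE) (h0 : bForm p q v0 v0 = 0)
    (h1 : bForm p q v v = 0) (h2 : bForm p q v0 v = 1) :
    ∃ e f : EE, bForm p q e e = 0 ∧ bForm p q f f = 0 ∧ bForm p q e f = 1 ∧
      bForm p q v0 e = 0 ∧ bForm p q v e = 0 ∧ bForm p q v0 f = 0 ∧ bForm p q v f = 0 := by
  have h2' : bForm p q v v0 = 1 := by rw [bF_comm, h2]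
  obtain ⟨f0, hf0, hf0'⟩ := exists_neg (q := q) hp (v0 - v)
  obtain ⟨e0, he0, he0'⟩ := exists_pos (p := p) hq (v0 + v)
  rw [bF_sub_right] at hf0
  rw [bF_add_right] at he0
  have hf0v : bForm p q f0 v = bForm p q f0 v0 := by linarith
  have he0v : bForm p q e0 v = - bForm p q e0 v0 := by linarith
  -- orthogonalise
  obtain ⟨f1, hf1a, hf1b, hf1c⟩ : ∃ f1 : EE, bForm p q v0 f1 = 0 ∧ bForm p q v f1 = 0 ∧
      bForm p q f1 f1 < 0 := by
    refine ⟨f0 - bForm p q f0 v0 • (v0 + v), ?_, ?_, ?_⟩ <;>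
    simp only [bF_sub_right, bF_sub_left, bF_add_left, bF_add_right, bF_smul_left, bF_smul_right,
      h0, h1, h2, h2', bF_comm v0 f0, bF_comm v f0, hf0v] <;> nlinarith [mul_self_nonneg (bForm p q f0 v0)]
  obtain ⟨e1, he1a, he1b, he1c⟩ : ∃ e1 : EE, bForm p q v0 e1 = 0 ∧ bForm p q v e1 = 0 ∧
      0 < bForm p q e1 e1 := by
    refine ⟨e0 + bForm p q e0 v0 • (v0 - v), ?_, ?_, ?_⟩ <;>
    simp only [bF_sub_right, bF_sub_left, bF_add_left, bF_add_right, bF_smul_left, bF_smul_right,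
      h0, h1, h2, h2', bF_comm v0 e0, bF_comm v e0, he0v] <;> nlinarith [mul_self_nonneg (bForm p q e0 v0)]
  obtain ⟨f2, hf2a, hf2b, hf2c, hf2d⟩ : ∃ f2 : EE, bForm p q v0 f2 = 0 ∧ bForm p q v f2 = 0 ∧
      bForm p q f2 f2 < 0 ∧ bForm p q e1 f2 = 0 := by
    have hfe := bF_comm f1 e1
    refine ⟨f1 - (bForm p q e1 f1 / bForm p q e1 e1) • e1, ?_, ?_, ?_, ?_⟩ <;>
    simp only [bF_sub_right, bF_sub_left, bF_smul_left, bF_smul_right, hf1a, hf1b, he1a, he1b, hfe]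
    · simp
    · simp
    · have : bForm p q e1 f1 / bForm p q e1 e1 * bForm p q e1 e1 = bForm p q e1 f1 := by field_simp
      rw [this]
      have : 0 ≤ bForm p q e1 f1 / bForm p q e1 e1 * bForm p q e1 f1 := by
        rw [div_mul_eq_mul_div]; exact div_nonneg (mul_self_nonneg _) he1c.le
      linarith
    · field_simp; ring
  set E := bForm p q e1 e1
  obtain ⟨F, hF⟩ : ∃ F, F = - bForm p q f2 f2 := ⟨_, rfl⟩
  have hFp : 0 < F := by linarith
  have hf2e : bForm p q f2 e1 = 0 := by rw [bF_comm, hf2d]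
  have hff : bForm p q f2 f2 = -F := by linarith
  have hE : bForm p q e1 e1 = E := rfl
  obtain ⟨a, ha⟩ : ∃ a, a = (√E)⁻¹ := ⟨_, rfl⟩
  obtain ⟨b, hb⟩ : ∃ b, b = (√F)⁻¹ := ⟨_, rfl⟩
  have haE : a * (a * E) = 1 := by
    have h1 := Real.sq_sqrt he1c.le
    have h2 := (Real.sqrt_pos.mpr he1c).ne'
    rw [ha]; field_simp; linarith
  have hbF : b * (b * F) = 1 := by
    have h1 := Real.sq_sqrt hFp.le
    have h2 := (Real.sqrt_pos.mpr hFp).ne'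
    rw [hb]; field_simp; linarith
  refine ⟨a • e1 + b • f2, (1/2 : ℝ) • (a • e1 - b • f2), ?_, ?_, ?_, ?_, ?_, ?_, ?_⟩ <;>
  simp only [bF_sub_right, bF_sub_left, bF_add_left, bF_add_right, bF_smul_left, bF_smul_right,
      he1a, he1b, hf2a, hf2b, hf2d, hf2e, hff, hE] <;> linarith

/-! ### The hyperbolic distance -/

lemma dHyp_eq {s t : ℝ} (hs : s ∈ II) (ht : t ∈ II) :
    dHyp s t = |Real.log ((1 + t) / (1 - t)) - Real.log ((1 + s) / (1 - s))| := by
  obtain ⟨hs1, hs2⟩ := hs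
  obtain ⟨ht1, ht2⟩ := ht
  have a1 : (1 + t) ≠ 0 := by linarith
  have a2 : (1 - t) ≠ 0 := by linarith
  have a3 : (1 + s) ≠ 0 := by linarith
  have a4 : (1 - s) ≠ 0 := by linarith
  unfold dHyp
  rw [Real.log_div (mul_ne_zero a1 a4) (mul_ne_zero a2 a3), Real.log_mul a1 a4,
    Real.log_mul a2 a3, Real.log_div a1 a2, Real.log_div a3 a4]
  congr 1; ring

lemma exists_param (y : ℝ) : ∃ s ∈ II, Real.log ((1 + s) / (1 - s)) = y := by
  have h := Real.exp_pos y
  refine ⟨(Real.exp y - 1) / (Real.exp y + 1), ⟨?_, ?_⟩, ?_⟩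
  · rw [lt_div_iff₀ (by linarith)]; linarith
  · rw [div_lt_iff₀ (by linarith)]; linarith
  · have : (1 + (Real.exp y - 1) / (Real.exp y + 1)) / (1 - (Real.exp y - 1) / (Real.exp y + 1))
        = Real.exp y := by
      have h' : Real.exp y + 1 ≠ 0 := by linarith
      have e1 : 1 + (Real.exp y - 1) / (Real.exp y + 1) = 2 * Real.exp y / (Real.exp y + 1) := by
        field_simp; ring
      have e2 : 1 - (Real.exp y - 1) / (Real.exp y + 1) = 2 / (Real.exp y + 1) := by
        field_simp; ring
      rw [e1, e2]; field_simp
    rw [this, Real.log_exp]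

lemma dHyp_split {s t : ℝ} (hs : s ∈ II) (ht : t ∈ II) {a : ℝ} (ha : 0 ≤ a)
    (ha' : a ≤ dHyp s t) : ∃ s' ∈ II, dHyp s s' = a ∧ dHyp s' t = dHyp s t - a := by
  rw [dHyp_eq hs ht] at *
  set S := Real.log ((1 + s) / (1 - s)) with hS
  set T := Real.log ((1 + t) / (1 - t)) with hT
  rcases le_total S T with h | h
  · obtain ⟨s', hs', h'⟩ := exists_param (S + a)
    refine ⟨s', hs', ?_, ?_⟩
    · rw [dHyp_eq hs hs', h', ← hS]; simp [abs_of_nonneg ha]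
    · rw [dHyp_eq hs' ht, h', ← hT]
      rw [abs_of_nonneg (by linarith)] at ha' ⊢
      rw [abs_of_nonneg (by linarith)]
      ring
  · obtain ⟨s', hs', h'⟩ := exists_param (S - a)
    refine ⟨s', hs', ?_, ?_⟩
    · rw [dHyp_eq hs hs', h', ← hS]; simp [abs_of_nonneg ha]
    · rw [dHyp_eq hs' ht, h', ← hT]
      rw [abs_of_nonpos (a := T - S) (by linarith)] at ha' ⊢
      rw [abs_of_nonpos (by linarith)]
      ring

lemma dHyp_lower {s t : ℝ} (hs : s ∈ II) (ht : t ∈ II) : |t - s| ≤ dHyp s t * (1 - t * s) := by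
  obtain ⟨hs1, hs2⟩ := hs
  obtain ⟨ht1, ht2⟩ := ht
  have hX : 0 < (1 + t) * (1 - s) := mul_pos (by linarith) (by linarith)
  have hY : 0 < (1 - t) * (1 + s) := mul_pos (by linarith) (by linarith)
  unfold dHyp
  obtain ⟨X, hXe⟩ : ∃ X, X = (1 + t) * (1 - s) := ⟨_, rfl⟩
  obtain ⟨Y, hYe⟩ : ∃ Y, Y = (1 - t) * (1 + s) := ⟨_, rfl⟩
  rw [← hXe] at hX ⊢
  rw [← hYe] at hY ⊢
  have e1 : t - s = (X - Y) / 2 := by rw [hXe, hYe]; ring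
  have e2 : 1 - t * s = (X + Y) / 2 := by rw [hXe, hYe]; ring
  rw [e1, e2]
  have key : ∀ X Y : ℝ, 0 < X → 0 < Y → (X - Y) / 2 ≤ |Real.log (X / Y)| * ((X + Y) / 2) := by
    intro X Y hX hY
    have h1 := Real.one_sub_inv_le_log_of_pos (div_pos hX hY)
    rw [inv_div] at h1
    have h2 := h1.trans (le_abs_self _)
    have h3 : X - Y ≤ |Real.log (X / Y)| * X := by
      have := mul_le_mul_of_nonneg_right h2 hX.le
      rwa [sub_mul, div_mul_cancel₀ _ hX.ne', one_mul] at this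
    nlinarith [abs_nonneg (Real.log (X / Y))]
  rw [abs_le]
  constructor
  · have := key Y X hY hX
    rw [← inv_div X Y, Real.log_inv, abs_neg] at this
    linarith
  · exact key X Y hX hY

lemma dHyp_small {η : ℝ} (hη : 0 < η) : ∃ M : ℝ, 1 < M ∧ dHyp (1 / M) 0 < η := by
  have hc : ContinuousAt (fun s : ℝ => dHyp s 0) 0 := by
    unfold dHyp
    refine ContinuousAt.abs (ContinuousAt.log ?_ (by norm_num))
    exact ContinuousAt.div (by fun_prop) (by fun_prop) (by norm_num)
  have h0 : dHyp 0 0 < η := by simpa [dHyp] using hη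
  have h1 : Tendsto (fun M : ℝ => 1 / M) atTop (𝓝 0) := by
    simpa using tendsto_inv_atTop_zero (𝕜 := ℝ)
  have h2 := (hc.tendsto.comp h1).eventually (gt_mem_nhds h0)
  obtain ⟨M, hM, hM'⟩ := (h2.and (eventually_gt_atTop 1)).exists
  exact ⟨M, hM', hM⟩

/-- Schwarz lemma for projective maps of an interval in a bounded set. -/
lemma schwarz {V : Type*} [NormedAddCommGroup V] [NormedSpace ℝ V] (A C : V) (a c R : ℝ)
    (hne : ∀ t ∈ II, t * a + c ≠ 0)
    (hR : ∀ t ∈ II, ‖(t * a + c)⁻¹ • (t • A + C)‖ ≤ R) {s t : ℝ} (hs : s ∈ II) (ht : t ∈ II) :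
    ‖(t * a + c)⁻¹ • (t • A + C) - (s * a + c)⁻¹ • (s • A + C)‖ ≤ 2 * R * dHyp s t := by
  have hdiff : ∀ s ∈ II, ∀ t ∈ II, (t * a + c)⁻¹ • (t • A + C) - (s * a + c)⁻¹ • (s • A + C)
      = ((t - s) / ((t * a + c) * (s * a + c))) • (c • A - a • C) := by
    intro s hs t ht
    have h1 := hne s hs
    have h2 := hne t ht
    have h1' : a * s + c ≠ 0 := by rwa [mul_comm]
    have h2' : a * t + c ≠ 0 := by rwa [mul_comm]
    match_scalars <;> field_simp <;> ring
  have hb : ∀ s ∈ II, ∀ t ∈ II,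
      |t - s| * ‖c • A - a • C‖ ≤ 2 * R * |(t * a + c) * (s * a + c)| := by
    intro s hs t ht
    have h1 := hdiff s hs t ht
    have h2 := norm_sub_le ((t * a + c)⁻¹ • (t • A + C)) ((s * a + c)⁻¹ • (s • A + C))
    rw [h1, norm_smul, Real.norm_eq_abs, abs_div] at h2
    have h3 := hR s hs
    have h4 := hR t ht
    have h5 : 0 < |(t * a + c) * (s * a + c)| :=
      abs_pos.mpr (mul_ne_zero (hne t ht) (hne s hs))
    rw [div_mul_eq_mul_div, div_le_iff₀ h5] at h2
    exact h2.trans (mul_le_mul_of_nonneg_right (by linarith) h5.le)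
  have hlim : 2 * ‖c • A - a • C‖ ≤ 2 * R * |(1 * a + c) * (-1 * a + c)| := by
    have hl : Tendsto (fun τ : ℝ => |τ - -τ| * ‖c • A - a • C‖) (𝓝[<] 1)
        (𝓝 (|(1 : ℝ) - -1| * ‖c • A - a • C‖)) := by
      apply Tendsto.mono_left _ nhdsWithin_le_nhds
      exact Continuous.tendsto (f := fun τ : ℝ => |τ - -τ| * ‖c • A - a • C‖) (by fun_prop) 1
    have hr : Tendsto (fun τ : ℝ => 2 * R * |(τ * a + c) * (-τ * a + c)|) (𝓝[<] 1)
        (𝓝 (2 * R * |(1 * a + c) * (-1 * a + c)|)) := by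
      apply Tendsto.mono_left _ nhdsWithin_le_nhds
      exact Continuous.tendsto (f := fun τ : ℝ => 2 * R * |(τ * a + c) * (-τ * a + c)|)
        (by fun_prop) 1
    have := le_of_tendsto_of_tendsto hl hr (by
      filter_upwards [Ioo_mem_nhdsLT (show (0:ℝ) < 1 by norm_num)] with τ hτ
      exact hb (-τ) ⟨by linarith [hτ.2], by linarith [hτ.1]⟩ τ ⟨by linarith [hτ.1], hτ.2⟩)
    norm_num at this ⊢
    exact this
  have hm : 0 ≤ c * c - a * a := by
    by_contra hcon
    push Not at hcon
    have hlt : |c| < |a| := by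
      rw [← sq_lt_sq]; nlinarith
    have ha : a ≠ 0 := by
      intro h; rw [h, abs_zero] at hlt; exact absurd hlt (not_lt.mpr (abs_nonneg _))
    apply hne (-c / a)
    · have : |-c / a| < 1 := by
        rw [abs_div, abs_neg, div_lt_one (abs_pos.mpr ha)]; exact hlt
      exact abs_lt.mp this
    · field_simp; ring
  have hR0 : 0 ≤ R := (norm_nonneg _).trans (hR t ht)
  have hE : ‖c • A - a • C‖ ≤ R * (c * c - a * a) := by
    have e : (1 * a + c) * (-1 * a + c) = c * c - a * a := by ring
    rw [e, abs_of_nonneg hm] at hlim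
    linarith
  have hts : 0 < 1 - t * s := by
    obtain ⟨hs1, hs2⟩ := hs
    obtain ⟨ht1, ht2⟩ := ht
    nlinarith [mul_pos (show 0 < 1 - t by linarith) (show 0 < 1 + s by linarith),
      mul_pos (show 0 < 1 + t by linarith) (show 0 < 1 - s by linarith)]
  have hl : (1 - t * s) * (c * c - a * a) ≤ 2 * ((t * a + c) * (s * a + c)) := by
    obtain ⟨hs1, hs2⟩ := hs
    obtain ⟨ht1, ht2⟩ := ht
    have h1 : 0 ≤ (1 + t) * (1 + s) := mul_nonneg (by linarith) (by linarith)
    have h2 : 0 ≤ (1 - t) * (1 - s) := mul_nonneg (by linarith) (by linarith)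
    nlinarith [mul_nonneg h1 (sq_nonneg (a + c)), mul_nonneg h2 (sq_nonneg (a - c))]
  have hl0 : 0 < (t * a + c) * (s * a + c) := by
    have h1 : 0 ≤ (t * a + c) * (s * a + c) := by nlinarith [mul_nonneg hts.le hm]
    exact lt_of_le_of_ne h1 (mul_ne_zero (hne t ht) (hne s hs)).symm
  rw [hdiff s hs t ht, norm_smul, Real.norm_eq_abs, abs_div, abs_of_pos hl0, div_mul_eq_mul_div,
    div_le_iff₀ hl0]
  have h1 := dHyp_lower hs ht
  have hd : 0 ≤ dHyp s t := abs_nonneg _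
  calc |t - s| * ‖c • A - a • C‖ ≤ (dHyp s t * (1 - t * s)) * (R * (c * c - a * a)) :=
        mul_le_mul h1 hE (norm_nonneg _) (mul_nonneg hd hts.le)
    _ = (dHyp s t * R) * ((1 - t * s) * (c * c - a * a)) := by ring
    _ ≤ (dHyp s t * R) * (2 * ((t * a + c) * (s * a + c))) :=
        mul_le_mul_of_nonneg_left hl (mul_nonneg hd hR0)
    _ = _ := by ring

/-! ### Chains -/

/-- Inductive version of chains. -/
inductive Reach (Ω : Set (ℙ ℝ EE)) (x : ℙ ℝ EE) : ℙ ℝ EE → ℝ → Prop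
  | refl : Reach Ω x x 0
  | step {y z : ℙ ℝ EE} {c s t : ℝ} {α : ℝ → ℙ ℝ EE} : Reach Ω x y c →
      IsLightGeodesic (bForm p q) Ω α → s ∈ II → t ∈ II → α s = y → α t = z →
      Reach Ω x z (c + dHyp s t)

lemma reach_of_chain {Ω : Set (ℙ ℝ EE)} {x : ℙ ℝ EE} (N : ℕ) :
    ∀ {y : ℙ ℝ EE} {c : ℝ}, IsChainCost (bForm p q) Ω x y N c → Reach Ω x y c := by
  induction N with
  | zero =>
    rintro y c ⟨xs, αs, ss, ts, h0, h1, -, hc⟩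
    have : x = y := by rw [← h0, ← h1]; rfl
    subst this
    rw [hc]; simpa using Reach.refl
  | succ N ih =>
    rintro y c ⟨xs, αs, ss, ts, h0, h1, h, hc⟩
    have hr : Reach Ω x (xs (Fin.last N).castSucc)
        (∑ i : Fin N, dHyp (ss i.castSucc) (ts i.castSucc)) := by
      apply ih
      refine ⟨fun i => xs i.castSucc, fun i => αs i.castSucc, fun i => ss i.castSucc,
        fun i => ts i.castSucc, ?_, rfl, ?_, rfl⟩
      · simpa using h0
      · intro i
        have := h i.castSucc
        simpa using this
    obtain ⟨g1, g2, g3, g4, g5⟩ := h (Fin.last N)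
    rw [hc, Fin.sum_univ_castSucc]
    refine Reach.step hr g1 g2 g3 g4 ?_
    rw [g5, ← h1]; rfl

lemma chain_append {Ω : Set (ℙ ℝ EE)} {x y z : ℙ ℝ EE} {N : ℕ} {c s t : ℝ} {α : ℝ → ℙ ℝ EE}
    (h : IsChainCost (bForm p q) Ω x y N c) (hα : IsLightGeodesic (bForm p q) Ω α)
    (hs : s ∈ II) (ht : t ∈ II) (h1 : α s = y) (h2 : α t = z) :
    IsChainCost (bForm p q) Ω x z (N + 1) (c + dHyp s t) := by
  obtain ⟨xs, αs, ss, ts, h0, hl, h, hc⟩ := h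
  refine ⟨Fin.snoc (α := fun _ => ℙ ℝ EE) xs z, Fin.snoc (α := fun _ => ℝ → ℙ ℝ EE) αs α,
    Fin.snoc (α := fun _ => ℝ) ss s, Fin.snoc (α := fun _ => ℝ) ts t, ?_, ?_, ?_, ?_⟩
  · rw [← Fin.castSucc_zero, Fin.snoc_castSucc, h0]
  · rw [Fin.snoc_last]
  · intro i
    refine Fin.lastCases ?_ (fun i => ?_) i
    · simp only [Fin.snoc_last, Fin.snoc_castSucc, Fin.succ_last]
      exact ⟨hα, hs, ht, by rw [h1, hl], h2⟩
    · rw [← Fin.castSucc_succ]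
      simp only [Fin.snoc_castSucc]
      exact h i
  · rw [Fin.sum_univ_castSucc]
    simp only [Fin.snoc_castSucc, Fin.snoc_last]
    rw [hc]

lemma chain_append_reach {Ω : Set (ℙ ℝ EE)} {x y z : ℙ ℝ EE} {N : ℕ} {c d : ℝ} (hN : 1 ≤ N)
    (h : IsChainCost (bForm p q) Ω x y N c) (h' : Reach Ω y z d) :
    ∃ N', 1 ≤ N' ∧ IsChainCost (bForm p q) Ω x z N' (c + d) := by
  induction h' with
  | refl => exact ⟨N, hN, by simpa using h⟩
  | step _ hα hs ht h1 h2 ih =>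
    obtain ⟨N', _, hch⟩ := ih
    refine ⟨N' + 1, by omega, ?_⟩
    rw [← add_assoc]
    exact chain_append hch hα hs ht h1 h2

lemma reach_nonneg {Ω : Set (ℙ ℝ EE)} {x y : ℙ ℝ EE} {c : ℝ} (h : Reach Ω x y c) : 0 ≤ c := by
  induction h with
  | refl => exact le_rfl
  | step _ _ _ _ _ _ ih => exact add_nonneg ih (abs_nonneg _)

lemma geod_mem {Ω : Set (ℙ ℝ EE)} {α : ℝ → ℙ ℝ EE} (h : IsLightGeodesic (bForm p q) Ω α) {t : ℝ}
    (ht : t ∈ II) : α t ∈ Ω := by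
  obtain ⟨u, w, a, b, c, d, -, -, -, -, -, h⟩ := h
  exact (h t ht).2.2

lemma reach_mem {Ω : Set (ℙ ℝ EE)} {x y : ℙ ℝ EE} {c : ℝ} (h : Reach Ω x y c) (hx : x ∈ Ω) :
    y ∈ Ω := by
  cases h with
  | refl => exact hx
  | step _ hα hs ht h1 h2 => rw [← h2]; exact geod_mem hα ht

lemma reach_split {Ω : Set (ℙ ℝ EE)} {x y : ℙ ℝ EE} {c : ℝ} (h : Reach Ω x y c) :
    ∀ {a : ℝ}, 0 ≤ a → a ≤ c → ∃ z, Reach Ω x z a ∧ Reach Ω z y (c - a) := by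
  induction h with
  | refl =>
    intro a h1 h2
    have : a = 0 := le_antisymm h2 h1
    subst this
    exact ⟨x, Reach.refl, by simpa using Reach.refl⟩
  | @step y z c s t α hr hα hs ht h1 h2 ih =>
    intro a ha ha'
    rcases le_total a c with h | h
    · obtain ⟨w, hw1, hw2⟩ := ih ha h
      refine ⟨w, hw1, ?_⟩
      have e : c + dHyp s t - a = (c - a) + dHyp s t := by ring
      rw [e]
      exact Reach.step hw2 hα hs ht h1 h2
    · obtain ⟨s', hs', e1, e2⟩ := dHyp_split hs ht (a := a - c) (by linarith) (by linarith)
      refine ⟨α s', ?_, ?_⟩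
      · have := Reach.step hr hα hs hs' h1 rfl
        rwa [e1, add_sub_cancel] at this
      · have := Reach.step (Reach.refl (Ω := Ω) (x := α s')) hα hs' ht rfl h2
        rw [e2] at this
        convert this using 1
        ring

/-! ### Projective points -/

/-- Total version of the projection to projective space. -/
def pr (v : EE) : ℙ ℝ EE :=
  open Classical in if h : v ≠ 0 then Projectivization.mk ℝ v h
  else Projectivization.mk ℝ (fun _ => 1) (fun h => one_ne_zero (congrFun h 0))

lemma pr_mk {v : EE} (h : v ≠ 0) : Projectivization.mk ℝ v h = pr v := by
  unfold pr; rw [dif_pos h]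

lemma pr_smul {a : ℝ} (ha : a ≠ 0) {v : EE} (h : v ≠ 0) : pr (a • v) = pr v := by
  rw [← pr_mk h, ← pr_mk (smul_ne_zero ha h), Projectivization.mk_eq_mk_iff']
  exact ⟨a, rfl⟩

lemma pr_rep (x : ℙ ℝ EE) : pr x.rep = x := by
  rw [← pr_mk x.rep_nonzero, Projectivization.mk_rep]

lemma rep_pr {v : EE} (h : v ≠ 0) : ∃ a : ℝ, a ≠ 0 ∧ (pr v).rep = a • v := by
  obtain ⟨a, ha⟩ := Projectivization.exists_smul_eq_mk_rep ℝ v h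
  rw [pr_mk h] at ha
  exact ⟨a, a.ne_zero, ha.symm⟩

lemma proj_pr (g : EE ≃ₗ[ℝ] EE) {v : EE} (h : v ≠ 0) : projMap g (pr v) = pr (g v) := by
  rw [← pr_mk h, ← pr_mk (g.map_ne_zero_iff.mpr h)]
  rfl

lemma ein_pr {v : EE} (h : v ≠ 0) : pr v ∈ einSet (bForm p q) ↔ bForm p q v v = 0 := by
  obtain ⟨a, ha, e⟩ := rep_pr h
  simp [einSet, e, bF_smul_left, bF_smul_right, ha]

lemma lc_pr {v : EE} (h : v ≠ 0) (x : ℙ ℝ EE) : pr v ∈ lightcone (bForm p q) x ↔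
    bForm p q v v = 0 ∧ bForm p q x.rep v = 0 := by
  obtain ⟨a, ha, e⟩ := rep_pr h
  simp [lightcone, ein_pr h, e, bF_smul_right, ha]

lemma quot_mk : IsQuotientMap (fun v : {v : EE // v ≠ 0} => pr (v : EE)) := by
  have : (fun v : {v : EE // v ≠ 0} => pr (v : EE)) = Quotient.mk (projectivizationSetoid ℝ EE) := by
    funext v
    rw [← pr_mk v.2]; rfl
  rw [this]
  exact isQuotientMap_quotient_mk'

lemma pr_cont : ContinuousOn (pr : EE → ℙ ℝ EE) {v | v ≠ 0} := by
  rw [continuousOn_iff_continuous_domRestrict]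
  exact quot_mk.continuous

/-- The affine chart. -/
def phi (v0 : EE) (x : ℙ ℝ EE) : EE := (bForm p q v0 x.rep)⁻¹ • x.rep

lemma phi_pr (v0 : EE) {v : EE} (h : v ≠ 0) : phi v0 (pr v) = (bForm p q v0 v)⁻¹ • v := by
  obtain ⟨a, ha, e⟩ := rep_pr h
  unfold phi
  rw [e, bF_smul_right, smul_smul]
  congr 1
  rw [mul_inv, mul_right_comm, inv_mul_cancel₀ ha, one_mul]

lemma phi_cont (v0 : EE) : ContinuousOn (phi v0) {x : ℙ ℝ EE | bForm p q v0 x.rep ≠ 0} := by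
  have hpre : (fun v : {v : EE // v ≠ 0} => pr (v : EE)) ⁻¹' {x : ℙ ℝ EE | bForm p q v0 x.rep ≠ 0}
      = {v : {v : EE // v ≠ 0} | bForm p q v0 (v : EE) ≠ 0} := by
    ext v
    obtain ⟨a, ha, e⟩ := rep_pr v.2
    simp [e, bF_smul_right, ha]
  have hc : Continuous fun v : {v : EE // v ≠ 0} => bForm p q v0 v :=
    bF_cont continuous_const continuous_subtype_val
  have hopen : IsOpen {x : ℙ ℝ EE | bForm p q v0 x.rep ≠ 0} := by
    rw [← quot_mk.isOpen_preimage, hpre]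
    exact isOpen_ne_fun hc continuous_const
  rw [quot_mk.continuousOn_isOpen_iff hopen, hpre]
  have : (phi v0 ∘ fun v : {v : EE // v ≠ 0} => pr (v : EE)) =
      fun v : {v : EE // v ≠ 0} => (bForm p q v0 (v : EE))⁻¹ • (v : EE) := by
    funext v; exact phi_pr v0 v.2
  rw [this]
  exact (hc.continuousOn.inv₀ fun v hv => hv).smul continuous_subtype_val.continuousOn

/-- The domain seen in the affine chart. -/
def DD (Ω : Set (ℙ ℝ EE)) (v0 : EE) : Set EE := {v | bForm p q v0 v = 1 ∧ pr v ∈ Ω}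

lemma ne_of_one {v0 v : EE} (h : bForm p q v0 v = 1) : v ≠ 0 := by
  rintro rfl; simp [bF_zero_right] at h

lemma phi_DD {Ω : Set (ℙ ℝ EE)} {v0 v : EE} (h : v ∈ DD Ω v0) : phi v0 (pr v) = v := by
  rw [phi_pr v0 (ne_of_one h.1), h.1]; simp

/-- The properties of the setting that we use. -/
structure Setting (Ω : Set (ℙ ℝ EE)) (v0 : EE) : Prop where
  null : bForm p q v0 v0 = 0
  sub : Ω ⊆ einSet (bForm p q)
  ne : ∀ x ∈ Ω, bForm p q v0 x.rep ≠ 0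
  opn : ∃ O : Set EE, IsOpen O ∧ ∀ v, bForm p q v0 v = 1 → bForm p q v v = 0 →
    (v ∈ O ↔ pr v ∈ Ω)
  bdd : ∃ R : ℝ, 0 < R ∧ ∀ v ∈ DD Ω v0, ‖v‖ ≤ R

lemma setting_of_proper {Ω : Set (ℙ ℝ EE)} (h : IsProperDomain (bForm p q) Ω) :
    ∃ v0, Setting Ω v0 := by
  obtain ⟨⟨hsub, hopen, -⟩, x0, hx0, hcl⟩ := h
  refine ⟨x0.rep, hx0, hsub, ?_, ?_, ?_⟩
  · intro x hx h0
    have : x ∈ closure Ω ∩ lightcone (bForm p q) x0 := ⟨subset_closure hx, hsub hx, h0⟩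
    rw [hcl] at this; exact this
  · obtain ⟨O', hO', e⟩ := isOpen_induced_iff.mp hopen
    have h1 : IsOpen ({v : EE | v ≠ 0} ∩ pr ⁻¹' O') :=
      pr_cont.isOpen_inter_preimage isOpen_ne hO'
    refine ⟨_, h1, fun v hv hv' => ?_⟩
    have hv0 := ne_of_one hv
    have hE : pr v ∈ einSet (bForm p q) := (ein_pr hv0).mpr hv'
    have : (⟨pr v, hE⟩ : einSet (bForm p q)) ∈ Subtype.val ⁻¹' O' ↔
        (⟨pr v, hE⟩ : einSet (bForm p q)) ∈ Subtype.val ⁻¹' Ω := by rw [e]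
    simpa [hv0] using this
  · by_contra hcon
    push Not at hcon
    have hk : ∀ k : ℕ, ∃ v ∈ DD Ω x0.rep, (k : ℝ) + 1 < ‖v‖ := fun k =>
      hcon (k + 1) (by positivity)
    choose v hv hvn using hk
    have hpos : ∀ k, 0 < ‖v k‖ := fun k => lt_trans (by positivity) (hvn k)
    have hvne : ∀ k, v k ≠ 0 := fun k => norm_pos_iff.mp (hpos k)
    have hmem : ∀ k, (‖v k‖⁻¹ • v k) ∈ Metric.sphere (0 : EE) 1 := by
      intro k
      simp [norm_smul, (hpos k).ne']
    obtain ⟨w, hw, φ, hφ, hlim⟩ := (isCompact_sphere (0 : EE) 1).tendsto_subseq hmem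
    have hw0 : w ≠ 0 := by
      rintro rfl; simp at hw
    have hclw : pr w ∈ closure Ω := by
      have h2 : Tendsto (fun k => pr (‖v (φ k)‖⁻¹ • v (φ k))) atTop (𝓝 (pr w)) :=
        ((pr_cont.continuousAt (isOpen_ne.mem_nhds hw0)).tendsto).comp hlim
      refine mem_closure_of_tendsto h2 (Eventually.of_forall fun k => ?_)
      rw [pr_smul (inv_ne_zero (hpos _).ne') (hvne _)]
      exact (hv _).2
    have hQ : bForm p q w w = 0 := by
      have h2 := ((bF_cont continuous_id continuous_id).tendsto w).comp hlim
      refine tendsto_nhds_unique h2 (tendsto_const_nhds.congr fun k => ?_)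
      have := (ein_pr (hvne (φ k))).mp (hsub (hv (φ k)).2)
      simp [bF_smul_left, bF_smul_right, this]
    have hB : bForm p q x0.rep w = 0 := by
      have h2 := ((bF_cont (continuous_const (y := x0.rep)) continuous_id).tendsto w).comp hlim
      refine tendsto_nhds_unique h2 ?_
      have h3 : Tendsto (fun k => ‖v k‖) atTop atTop :=
        tendsto_atTop_mono (fun k => by linarith [hvn k]) tendsto_natCast_atTop_atTop
      refine ((tendsto_inv_atTop_zero.comp h3).comp hφ.tendsto_atTop).congr fun k => ?_
      simp [bF_smul_right, (hv (φ k)).1]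
    have : pr w ∈ closure Ω ∩ lightcone (bForm p q) x0 := ⟨hclw, (lc_pr hw0 x0).mpr ⟨hQ, hB⟩⟩
    rw [hcl] at this; exact this

lemma DD_null {Ω : Set (ℙ ℝ EE)} {v0 : EE} (S : Setting Ω v0) {v : EE} (h : v ∈ DD Ω v0) :
    bForm p q v v = 0 := (ein_pr (ne_of_one h.1)).mp (S.sub h.2)

lemma pr_phi {Ω : Set (ℙ ℝ EE)} {v0 : EE} (S : Setting Ω v0) {x : ℙ ℝ EE} (h : x ∈ Ω) :
    pr (phi v0 x) = x := by
  unfold phi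
  rw [pr_smul (inv_ne_zero (S.ne x h)) x.rep_nonzero, pr_rep]

lemma phi_mem {Ω : Set (ℙ ℝ EE)} {v0 : EE} (S : Setting Ω v0) {x : ℙ ℝ EE} (h : x ∈ Ω) :
    phi v0 x ∈ DD Ω v0 := by
  refine ⟨?_, by rwa [pr_phi S h]⟩
  unfold phi
  rw [bF_smul_right, inv_mul_cancel₀ (S.ne x h)]

lemma geod_bound {Ω : Set (ℙ ℝ EE)} {v0 : EE} (S : Setting Ω v0) {R : ℝ}
    (hR : ∀ v ∈ DD Ω v0, ‖v‖ ≤ R) {α : ℝ → ℙ ℝ EE} (hα : IsLightGeodesic (bForm p q) Ω α)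
    {s t : ℝ} (hs : s ∈ II) (ht : t ∈ II) :
    ‖phi v0 (α t) - phi v0 (α s)‖ ≤ 2 * R * dHyp s t := by
  obtain ⟨u, w, a, b, c, d, -, -, -, -, -, h⟩ := hα
  have e : ∀ t : ℝ, (a * t + b) • u + (c * t + d) • w = t • (a • u + c • w) + (b • u + d • w) := by
    intro t; module
  have key : ∀ t ∈ II, t * bForm p q v0 (a • u + c • w) + bForm p q v0 (b • u + d • w) ≠ 0 ∧
      phi v0 (α t) = (t * bForm p q v0 (a • u + c • w) + bForm p q v0 (b • u + d • w))⁻¹ •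
        (t • (a • u + c • w) + (b • u + d • w)) ∧ ‖phi v0 (α t)‖ ≤ R := by
    intro t ht
    obtain ⟨hne, h1, h2⟩ := h t ht
    rw [pr_mk hne] at h1
    rw [e] at hne h1
    have h3 := phi_mem S h2
    have h4 : bForm p q v0 (t • (a • u + c • w) + (b • u + d • w)) =
        t * bForm p q v0 (a • u + c • w) + bForm p q v0 (b • u + d • w) := by
      rw [bF_add_right, bF_smul_right]
    refine ⟨?_, ?_, hR _ h3⟩
    · intro h0
      have := h3.1
      rw [h1, phi_pr v0 hne, h4, h0] at this
      simp [bF_zero_right] at this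
    · rw [h1, phi_pr v0 hne, h4]
  rw [(key s hs).2.1, (key t ht).2.1]
  refine schwarz _ _ _ _ R (fun t ht => (key t ht).1) (fun t ht => ?_) hs ht
  rw [← (key t ht).2.1]; exact (key t ht).2.2

lemma reach_bound {Ω : Set (ℙ ℝ EE)} {v0 : EE} (S : Setting Ω v0) {R : ℝ}
    (hR : ∀ v ∈ DD Ω v0, ‖v‖ ≤ R) {x y : ℙ ℝ EE} {c : ℝ} (h : Reach Ω x y c) :
    ‖phi v0 y - phi v0 x‖ ≤ 2 * R * c := by
  induction h with
  | refl => simp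
  | @step y z c s t α hr hα hs ht h1 h2 ih =>
    subst h1 h2
    have h3 := geod_bound S hR hα hs ht
    have h4 := norm_sub_le_norm_sub_add_norm_sub (phi v0 (α t)) (phi v0 (α s)) (phi v0 x)
    linarith

/-! ### Conformal maps -/

lemma conf_bF {Ω : Set (ℙ ℝ EE)} {g : EE ≃ₗ[ℝ] EE} (hg : g ∈ Conf (bForm p q) Ω) (u w : EE) :
    bForm p q (g u) (g w) = bForm p q u w := by
  have h1 := hg.1 (u + w)
  have h2 := hg.1 u
  have h3 := hg.1 w
  rw [map_add] at h1
  simp only [bF_add_left, bF_add_right] at h1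
  rw [bF_comm w u, bF_comm (g w) (g u)] at h1
  linarith

lemma proj_ne (g : EE ≃ₗ[ℝ] EE) (x : ℙ ℝ EE) : projMap g.symm (projMap g x) = x := by
  rw [← pr_rep x, proj_pr g x.rep_nonzero, proj_pr g.symm (g.map_ne_zero_iff.mpr x.rep_nonzero)]
  simp

lemma proj_ne' (g : EE ≃ₗ[ℝ] EE) (x : ℙ ℝ EE) : projMap g (projMap g.symm x) = x := proj_ne g.symm x

lemma conf_symm {Ω : Set (ℙ ℝ EE)} {g : EE ≃ₗ[ℝ] EE} (hg : g ∈ Conf (bForm p q) Ω) :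
    g.symm ∈ Conf (bForm p q) Ω := by
  refine ⟨fun v => ?_, ?_⟩
  · have := hg.1 (g.symm v)
    simpa using this.symm
  · conv_lhs => rw [← hg.2]
    rw [image_image]
    simp [proj_ne]

lemma conf_mem {Ω : Set (ℙ ℝ EE)} {g : EE ≃ₗ[ℝ] EE} (hg : g ∈ Conf (bForm p q) Ω) {x : ℙ ℝ EE}
    (hx : x ∈ Ω) : projMap g x ∈ Ω := by
  rw [← hg.2]; exact mem_image_of_mem _ hx

lemma conf_geod {Ω : Set (ℙ ℝ EE)} {g : EE ≃ₗ[ℝ] EE} (hg : g ∈ Conf (bForm p q) Ω)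
    {α : ℝ → ℙ ℝ EE} (hα : IsLightGeodesic (bForm p q) Ω α) :
    IsLightGeodesic (bForm p q) Ω (fun t => projMap g (α t)) := by
  obtain ⟨u, w, a, b, c, d, hl, h1, h2, h3, h4, h⟩ := hα
  refine ⟨g u, g w, a, b, c, d, ?_, ?_, ?_, ?_, h4, ?_⟩
  · have := hl.map' (g : EE →ₗ[ℝ] EE) g.ker
    have e : (g : EE →ₗ[ℝ] EE) ∘ ![u, w] = ![g u, g w] := by
      ext i j
      fin_cases i <;> rfl
    rwa [e] at this
  · rw [conf_bF hg, h1]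
  · rw [conf_bF hg, h2]
  · rw [conf_bF hg, h3]
  · intro t ht
    obtain ⟨hne, e, hm⟩ := h t ht
    have e2 : (a * t + b) • g u + (c * t + d) • g w = g ((a * t + b) • u + (c * t + d) • w) := by
      simp
    have hne' : (a * t + b) • g u + (c * t + d) • g w ≠ 0 := by
      rw [e2]; exact g.map_ne_zero_iff.mpr hne
    refine ⟨hne', ?_, conf_mem hg hm⟩
    change projMap g (α t) = _
    rw [e, pr_mk, pr_mk, proj_pr g hne, e2]

lemma conf_reach {Ω : Set (ℙ ℝ EE)} {g : EE ≃ₗ[ℝ] EE} (hg : g ∈ Conf (bForm p q) Ω)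
    {x y : ℙ ℝ EE} {c : ℝ} (h : Reach Ω x y c) : Reach Ω (projMap g x) (projMap g y) c := by
  induction h with
  | refl => exact Reach.refl
  | @step y z c s t α hr hα hs ht h1 h2 ih =>
    subst h1 h2
    exact Reach.step ih (conf_geod hg hα) hs ht rfl rfl

/-- Action of a linear map on the affine chart. -/
def psi (v0 : EE) (g : EE ≃ₗ[ℝ] EE) (v : EE) : EE := (bForm p q v0 (g v))⁻¹ • g v

lemma psi_eq {v0 : EE} (g : EE ≃ₗ[ℝ] EE) {v : EE} (hv : v ≠ 0) :
    phi v0 (projMap g (pr v)) = psi v0 g v := by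
  rw [proj_pr g hv, phi_pr v0 (g.map_ne_zero_iff.mpr hv)]; rfl

lemma psi_mem {Ω : Set (ℙ ℝ EE)} {v0 : EE} (S : Setting Ω v0) {g : EE ≃ₗ[ℝ] EE}
    (hg : g ∈ Conf (bForm p q) Ω) {v : EE} (hv : v ∈ DD Ω v0) : psi v0 g v ∈ DD Ω v0 := by
  rw [← psi_eq g (ne_of_one hv.1)]
  exact phi_mem S (conf_mem hg hv.2)

lemma psi_cont {Ω : Set (ℙ ℝ EE)} {v0 : EE} (S : Setting Ω v0) {g : EE ≃ₗ[ℝ] EE}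
    (hg : g ∈ Conf (bForm p q) Ω) : ContinuousOn (psi v0 g) (DD Ω v0) := by
  have hgc : Continuous g := LinearMap.continuous_of_finiteDimensional (g : EE →ₗ[ℝ] EE)
  refine ContinuousOn.smul (ContinuousOn.inv₀ (bF_cont continuous_const hgc).continuousOn ?_)
    hgc.continuousOn
  intro v hv h0
  have := (psi_mem S hg hv).1
  rw [psi, h0] at this
  simp [bF_zero_right] at this

/-- Uniform growth of compact sets. -/
lemma growth {Ω : Set (ℙ ℝ EE)} {v0 : EE} (S : Setting Ω v0)
    (hqh : IsQuasiHomogeneous (bForm p q) Ω) :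
    ∃ ε : ℝ, 0 < ε ∧ ∀ L : Set EE, IsCompact L → L ⊆ DD Ω v0 →
      ∃ L' : Set EE, (IsCompact L' ∧ L' ⊆ DD Ω v0) ∧
        ∀ v ∈ L, ∀ y c, Reach Ω (pr v) y c → c ≤ ε → phi v0 y ∈ L' := by
  obtain ⟨K, hKΩ, hK, hcov⟩ := hqh
  obtain ⟨R, hR0, hR⟩ := S.bdd
  obtain ⟨O, hO, hOe⟩ := S.opn
  have hK' : IsCompact (phi v0 '' K) := hK.image_of_continuousOn
    ((phi_cont v0).mono fun x hx => S.ne x (hKΩ hx))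
  have hKD : phi v0 '' K ⊆ DD Ω v0 := by
    rintro _ ⟨x, hx, rfl⟩; exact phi_mem S (hKΩ hx)
  have hKO : phi v0 '' K ⊆ O := fun v hv =>
    (hOe v (hKD hv).1 (DD_null S (hKD hv))).mpr (hKD hv).2
  obtain ⟨ε0, hε0, hth⟩ := hK'.exists_cthickening_subset_open hO hKO
  let K2 : Set EE := Metric.cthickening ε0 (phi v0 '' K) ∩
    ({v | bForm p q v0 v = 1} ∩ {v | bForm p q v v = 0})
  have hK2 : IsCompact K2 := hK'.cthickening.inter_right
    ((isClosed_eq (bF_cont continuous_const continuous_id) continuous_const).inter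
      (isClosed_eq (bF_cont continuous_id continuous_id) continuous_const))
  have hK2D : K2 ⊆ DD Ω v0 := fun v hv => ⟨hv.2.1, (hOe v hv.2.1 hv.2.2).mp (hth hv.1)⟩
  refine ⟨ε0 / (4 * R), by positivity, fun L hL hLD => ?_⟩
  revert hLD
  intro hLD
  refine hL.induction_on (p := fun L => ∃ L' : Set EE, (IsCompact L' ∧ L' ⊆ DD Ω v0) ∧
        ∀ v ∈ L, ∀ y c, Reach Ω (pr v) y c → c ≤ ε0 / (4 * R) → phi v0 y ∈ L') ?_ ?_ ?_ ?_
  · exact ⟨∅, ⟨isCompact_empty, empty_subset _⟩, by simp⟩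
  · rintro s t hst ⟨L', h1, h2⟩
    exact ⟨L', h1, fun v hv => h2 v (hst hv)⟩
  · rintro s t ⟨L1, h1, h2⟩ ⟨L2, h3, h4⟩
    refine ⟨L1 ∪ L2, ⟨h1.1.union h3.1, union_subset h1.2 h3.2⟩, ?_⟩
    rintro v (hv | hv) y c hr hc
    · exact Or.inl (h2 v hv y c hr hc)
    · exact Or.inr (h4 v hv y c hr hc)
  · intro v hv
    have hvD := hLD hv
    have hvΩ := hvD.2
    rw [hcov] at hvΩ
    simp only [mem_iUnion] at hvΩ
    obtain ⟨g, hg, k, hk, hgk⟩ := hvΩ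
    have hg' := conf_symm hg
    have hψ : psi v0 g.symm v = phi v0 k := by
      rw [← psi_eq g.symm (ne_of_one hvD.1), ← hgk, proj_ne]
    have hc := ((psi_cont S hg').mono hLD) v hv
    have hnh := hc (Metric.ball_mem_nhds (psi v0 g.symm v) (half_pos hε0))
    refine ⟨_, inter_mem hnh self_mem_nhdsWithin, psi v0 g '' K2,
      ⟨hK2.image_of_continuousOn ((psi_cont S hg).mono hK2D), ?_⟩, ?_⟩
    · rintro _ ⟨w, hw, rfl⟩; exact psi_mem S hg (hK2D hw)
    · rintro v' ⟨hv', hv'L⟩ y c hr hcε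
      have hv'D := hLD hv'L
      have hyΩ := reach_mem hr hv'D.2
      have hb := reach_bound S hR (conf_reach hg' hr)
      rw [psi_eq g.symm (ne_of_one hv'D.1)] at hb
      have hb2 : 2 * R * c ≤ ε0 / 2 := by
        calc 2 * R * c ≤ 2 * R * (ε0 / (4 * R)) := by gcongr
          _ = ε0 / 2 := by field_simp; ring
      have hyD := phi_mem S (conf_mem hg' hyΩ)
      refine ⟨phi v0 (projMap g.symm y), ⟨?_, hyD.1, DD_null S hyD⟩, ?_⟩
      · refine Metric.mem_cthickening_of_dist_le _ (phi v0 k) _ _ ⟨k, hk, rfl⟩ ?_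
        have h1 : dist (psi v0 g.symm v') (psi v0 g.symm v) < ε0 / 2 := hv'
        rw [hψ] at h1
        have h2 := dist_triangle (phi v0 (projMap g.symm y)) (psi v0 g.symm v') (phi v0 k)
        rw [dist_eq_norm (phi v0 (projMap g.symm y)) (psi v0 g.symm v')] at h2
        linarith
      · rw [← psi_eq g (ne_of_one hyD.1), pr_phi S (conf_mem hg' hyΩ), proj_ne']

lemma reach_compact {Ω : Set (ℙ ℝ EE)} {v0 : EE} (S : Setting Ω v0)
    (hqh : IsQuasiHomogeneous (bForm p q) Ω) {x : ℙ ℝ EE} (hx : x ∈ Ω) (r : ℝ) :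
    ∃ L : Set EE, IsCompact L ∧ L ⊆ DD Ω v0 ∧ ∀ y c, Reach Ω x y c → c ≤ r → phi v0 y ∈ L := by
  obtain ⟨ε, hε, H⟩ := growth S hqh
  have key : ∀ k : ℕ, ∃ L : Set EE, IsCompact L ∧ L ⊆ DD Ω v0 ∧
      ∀ y c, Reach Ω x y c → c ≤ k * ε → phi v0 y ∈ L := by
    intro k
    induction k with
    | zero =>
      obtain ⟨L, h1, h2⟩ := H {phi v0 x} isCompact_singleton (by
        simpa using phi_mem S hx)
      refine ⟨L, h1.1, h1.2, fun y c hr hc => h2 _ rfl y c ?_ ?_⟩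
      · rwa [pr_phi S hx]
      · simp at hc; linarith
    | succ k ih =>
      obtain ⟨L, h1, h2, h3⟩ := ih
      obtain ⟨L', h4, h5⟩ := H L h1 h2
      refine ⟨L', h4.1, h4.2, fun y c hr hc => ?_⟩
      have hc0 := reach_nonneg hr
      obtain ⟨z, hz1, hz2⟩ := reach_split hr (a := min c (k * ε)) (le_min hc0 (by positivity))
        (min_le_left _ _)
      refine h5 _ (h3 z _ hz1 (min_le_right _ _)) y _
        (by rw [pr_phi S (reach_mem hz1 hx)]; exact hz2) ?_
      push_cast at hc
      rcases le_total c (k * ε) with h | h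
      · rw [min_eq_left h]; linarith
      · rw [min_eq_right h]; linarith
  obtain ⟨k, hk⟩ := exists_nat_ge (r / ε)
  obtain ⟨L, h1, h2, h3⟩ := key k
  refine ⟨L, h1, h2, fun y c hr hc => h3 y c hr ?_⟩
  rw [div_le_iff₀ hε] at hk
  linarith

/-! ### Local chains -/

lemma step_back {Ω : Set (ℙ ℝ EE)} {v0 v : EE} {ρ M : ℝ} (hM : 1 < M)
    (hρ : ∀ w, bForm p q v0 w = 1 → bForm p q w w = 0 → ‖w - v‖ < ρ → pr w ∈ Ω)
    {a z : EE} (h1 : bForm p q v0 a = 1) (h2 : bForm p q a a = 0) (h3 : bForm p q z a = 0)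
    (h4 : bForm p q z z = 0) (h5 : bForm p q v0 z = 0) (hs : ‖a - v‖ + M * ‖z‖ < ρ)
    {x : ℙ ℝ EE} {c : ℝ} (hr : Reach Ω x (pr (a + z)) c) :
    ∃ c', c' ≤ c + dHyp (1 / M) 0 ∧ Reach Ω x (pr a) c' := by
  by_cases hz : z = 0
  · subst hz
    refine ⟨c, ?_, by simpa using hr⟩
    have : 0 ≤ dHyp (1 / M) 0 := abs_nonneg _
    linarith
  have hM0 : 0 < M := by linarith
  have hMII : 1 / M ∈ II := by
    refine ⟨lt_trans (by norm_num) (one_div_pos.mpr hM0), ?_⟩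
    rw [div_lt_one hM0]; exact hM
  have h0II : (0 : ℝ) ∈ II := ⟨by norm_num, by norm_num⟩
  have hB : ∀ t : ℝ, bForm p q v0 ((M * t + 0) • z + (0 * t + 1) • a) = 1 := by
    intro t
    simp only [bF_add_right, bF_smul_right, h5, h1]; ring
  have hα : IsLightGeodesic (bForm p q) Ω (fun t => pr ((M * t + 0) • z + (0 * t + 1) • a)) := by
    refine ⟨z, a, M, 0, 0, 1, ?_, h4, h3, h2, by simpa using hM0.ne', fun t ht => ?_⟩
    · rw [LinearIndependent.pair_iff]
      intro s t hst
      have := congrArg (bForm p q v0) hst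
      simp only [bF_add_right, bF_smul_right, h5, h1, bF_zero_right] at this
      have ht : t = 0 := by linarith
      subst ht
      simp only [zero_smul, add_zero, smul_eq_zero, hz, or_false] at hst
      exact ⟨hst, rfl⟩
    · refine ⟨ne_of_one (hB t), (pr_mk _).symm, hρ _ (hB t) ?_ ?_⟩
      · simp only [bF_add_right, bF_add_left, bF_smul_left, bF_smul_right, h4, h3, h2,
          bF_comm a z]; ring
      · have e : (M * t + 0) • z + (0 * t + 1) • a - v = (a - v) + (M * t) • z := by module
        rw [e]
        refine lt_of_le_of_lt (norm_add_le _ _) (lt_of_le_of_lt ?_ hs)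
        rw [norm_smul, Real.norm_eq_abs, abs_mul, abs_of_pos hM0]
        have : |t| ≤ 1 := (abs_lt.mpr ht).le
        have h6 := norm_nonneg z
        have h7 : M * |t| * ‖z‖ ≤ M * 1 * ‖z‖ := by gcongr
        linarith
  refine ⟨_, le_rfl, Reach.step hr hα hMII h0II ?_ ?_⟩
  · change pr ((M * (1 / M) + 0) • z + (0 * (1 / M) + 1) • a) = _
    congr 1
    rw [mul_one_div_cancel hM0.ne']; module
  · change pr ((M * 0 + 0) • z + (0 * 0 + 1) • a) = _
    congr 1
    module

lemma three_steps {Ω : Set (ℙ ℝ EE)} {v0 v e f y : EE} {ρ M s t al be : ℝ} (hM : 1 < M)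
    (hρ : ∀ w, bForm p q v0 w = 1 → bForm p q w w = 0 → ‖w - v‖ < ρ → pr w ∈ Ω)
    (h00 : bForm p q v0 v0 = 0) (h0v : bForm p q v0 v = 1) (hvv : bForm p q v v = 0)
    (h0e : bForm p q v0 e = 0) (h0f : bForm p q v0 f = 0) (hve : bForm p q v e = 0)
    (hvf : bForm p q v f = 0) (hee : bForm p q e e = 0) (hff : bForm p q f f = 0)
    (hef : bForm p q e f = 1) (h0y : bForm p q v0 y = 0) (hvy : bForm p q v y = 0)
    (hey : bForm p q e y = 0) (hfy : bForm p q f y = 0) (hyy : bForm p q y y + 2 * s * t = 0)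
    (C1 : M * ‖y + s • e + t • f‖ < ρ)
    (C2 : ‖y + s • e + t • f‖ + M * ‖(al - s) • e - ((al - s) * t) • v0‖ < ρ)
    (C3 : ‖y + s • e + t • f + ((al - s) • e - ((al - s) * t) • v0)‖ +
      M * ‖(be - t) • f - ((be - t) * al) • v0‖ < ρ) :
    ∃ c, c ≤ 3 * dHyp (1 / M) 0 ∧ Reach Ω (pr (v + (y + s • e + t • f) +
      ((al - s) • e - ((al - s) * t) • v0) + ((be - t) • f - ((be - t) * al) • v0))) (pr v) c := by
  have hyy' : bForm p q y y = - (2 * s * t) := by linarith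
  have hv0 : bForm p q v v0 = 1 := by rw [bF_comm, h0v]
  have he0 : bForm p q e v0 = 0 := by rw [bF_comm, h0e]
  have hf0 : bForm p q f v0 = 0 := by rw [bF_comm, h0f]
  have hy0 : bForm p q y v0 = 0 := by rw [bF_comm, h0y]
  have hev : bForm p q e v = 0 := by rw [bF_comm, hve]
  have hfv : bForm p q f v = 0 := by rw [bF_comm, hvf]
  have hyv : bForm p q y v = 0 := by rw [bF_comm, hvy]
  have hfe : bForm p q f e = 1 := by rw [bF_comm, hef]
  have hye : bForm p q y e = 0 := by rw [bF_comm, hey]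
  have hyf : bForm p q y f = 0 := by rw [bF_comm, hfy]
  obtain ⟨c1, hc1, hr1⟩ := step_back (v0 := v0) (v := v) hM hρ
    (a := v + (y + s • e + t • f) + ((al - s) • e - ((al - s) * t) • v0))
    (z := (be - t) • f - ((be - t) * al) • v0)
    (by simp only [bF_add_right, bF_sub_right, bF_smul_right, *]; ring)
    (by simp only [bF_add_right, bF_sub_right, bF_smul_right, bF_add_left, bF_sub_left,
          bF_smul_left, *]; ring)
    (by simp only [bF_add_right, bF_sub_right, bF_smul_right, bF_add_left, bF_sub_left,
          bF_smul_left, *]; ring)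
    (by simp only [bF_sub_right, bF_smul_right, bF_sub_left, bF_smul_left, *]; ring)
    (by simp only [bF_sub_right, bF_smul_right, *]; ring)
    (by rw [add_assoc v, add_sub_cancel_left]; exact C3) Reach.refl
  obtain ⟨c2, hc2, hr2⟩ := step_back (v0 := v0) (v := v) hM hρ
    (a := v + (y + s • e + t • f))
    (z := (al - s) • e - ((al - s) * t) • v0)
    (by simp only [bF_add_right, bF_smul_right, *]; ring)
    (by simp only [bF_add_right, bF_smul_right, bF_add_left, bF_smul_left, *]; ring)
    (by simp only [bF_add_right, bF_smul_right, bF_sub_left, bF_smul_left, *]; ring)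
    (by simp only [bF_sub_right, bF_smul_right, bF_sub_left, bF_smul_left, *]; ring)
    (by simp only [bF_sub_right, bF_smul_right, *]; ring)
    (by rw [add_sub_cancel_left]; exact C2) hr1
  obtain ⟨c3, hc3, hr3⟩ := step_back (v0 := v0) (v := v) hM hρ (a := v) (z := y + s • e + t • f)
    h0v hvv
    (by simp only [bF_add_left, bF_smul_left, *]; ring)
    (by simp only [bF_add_right, bF_smul_right, bF_add_left, bF_smul_left, *]; ring)
    (by simp only [bF_add_right, bF_smul_right, *]; ring)
    (by simpa using C1) hr2
  exact ⟨c3, by linarith, hr3⟩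

lemma local_chain (hp : 1 ≤ p) (hq : 1 ≤ q) {Ω : Set (ℙ ℝ EE)} {v0 : EE} (S : Setting Ω v0)
    {v : EE} (hv : v ∈ DD Ω v0) {η : ℝ} (hη : 0 < η) :
    ∀ᶠ w in 𝓝 v, w ∈ DD Ω v0 → ∃ c, c ≤ η ∧ Reach Ω (pr w) (pr v) c := by
  obtain ⟨M, hM, hMη⟩ := dHyp_small (show 0 < η / 3 by positivity)
  have hvv := DD_null S hv
  have h0v := hv.1
  have h00 := S.null
  obtain ⟨e, f, hee, hff, hef, h0e, hve, h0f, hvf⟩ := exists_hyp hp hq v0 v h00 hvv h0v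
  obtain ⟨O, hO, hOe⟩ := S.opn
  obtain ⟨ρ, hρ0, hball⟩ := Metric.isOpen_iff.mp hO v ((hOe v h0v hvv).mpr hv.2)
  have hρ : ∀ w, bForm p q v0 w = 1 → bForm p q w w = 0 → ‖w - v‖ < ρ → pr w ∈ Ω := by
    intro w h1 h2 h3
    exact (hOe w h1 h2).mp (hball (by rwa [Metric.mem_ball, dist_eq_norm]))
  have hM0 : 0 < 1 + M := by linarith
  have he1 : 0 < ‖e‖ + 1 := by positivity
  obtain ⟨s, hs0, hs⟩ : ∃ s : ℝ, 0 < s ∧ (1 + M) * (s * ‖e‖) < ρ := by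
    refine ⟨ρ / ((1 + M) * (‖e‖ + 1)), by positivity, ?_⟩
    have : (1 + M) * (ρ / ((1 + M) * (‖e‖ + 1)) * ‖e‖) = ρ * (‖e‖ / (‖e‖ + 1)) := by
      field_simp
    rw [this]
    have : ‖e‖ / (‖e‖ + 1) < 1 := by rw [div_lt_one he1]; linarith
    nlinarith
  -- the coordinates of `w`
  obtain ⟨X, hX⟩ : ∃ X : EE → EE, X = fun w => w - v - bForm p q w v • v0 := ⟨_, rfl⟩
  obtain ⟨al, hal⟩ : ∃ al : EE → ℝ, al = fun w => bForm p q (X w) f := ⟨_, rfl⟩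
  obtain ⟨be, hbe⟩ : ∃ be : EE → ℝ, be = fun w => bForm p q (X w) e := ⟨_, rfl⟩
  obtain ⟨Y, hY⟩ : ∃ Y : EE → EE, Y = fun w => X w - al w • e - be w • f := ⟨_, rfl⟩
  obtain ⟨t, ht⟩ : ∃ t : EE → ℝ, t = fun w => - bForm p q (Y w) (Y w) / (2 * s) := ⟨_, rfl⟩
  have cX : Continuous X := by
    rw [hX]
    exact (continuous_id.sub continuous_const).sub
      ((bF_cont continuous_id continuous_const).smul continuous_const)
  have cal : Continuous al := by rw [hal]; exact bF_cont cX continuous_const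
  have cbe : Continuous be := by rw [hbe]; exact bF_cont cX continuous_const
  have cY : Continuous Y := by rw [hY]; fun_prop
  have ct : Continuous t := by rw [ht]; exact (bF_cont cY cY).neg.div_const _
  have X0 : X v = 0 := by rw [hX]; simp [hvv]
  have al0 : al v = 0 := by rw [hal]; simp [X0, bF_zero_left]
  have be0 : be v = 0 := by rw [hbe]; simp [X0, bF_zero_left]
  have Y0 : Y v = 0 := by rw [hY]; simp [X0, al0, be0]
  have t0 : t v = 0 := by rw [ht]; simp [Y0, bF_zero_left]
  have E1 : ∀ᶠ w in 𝓝 v, M * ‖Y w + s • e + t w • f‖ < ρ := by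
    have c : Continuous fun w => M * ‖Y w + s • e + t w • f‖ := by fun_prop
    refine (c.tendsto v).eventually (gt_mem_nhds ?_)
    simp only [Y0, t0, zero_smul, add_zero, zero_add, norm_smul, Real.norm_eq_abs, abs_of_pos hs0]
    have : 0 ≤ s * ‖e‖ := by positivity
    linarith
  have E2 : ∀ᶠ w in 𝓝 v, ‖Y w + s • e + t w • f‖ +
      M * ‖(al w - s) • e - ((al w - s) * t w) • v0‖ < ρ := by
    have c : Continuous fun w => ‖Y w + s • e + t w • f‖ +
      M * ‖(al w - s) • e - ((al w - s) * t w) • v0‖ := by fun_prop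
    refine (c.tendsto v).eventually (gt_mem_nhds ?_)
    simp only [Y0, t0, al0, zero_smul, add_zero, zero_add, mul_zero, sub_zero, zero_sub,
      norm_smul, Real.norm_eq_abs, abs_neg, abs_of_pos hs0]
    linarith
  have E3 : ∀ᶠ w in 𝓝 v, ‖Y w + s • e + t w • f + ((al w - s) • e - ((al w - s) * t w) • v0)‖ +
      M * ‖(be w - t w) • f - ((be w - t w) * al w) • v0‖ < ρ := by
    have c : Continuous fun w =>
      ‖Y w + s • e + t w • f + ((al w - s) • e - ((al w - s) * t w) • v0)‖ +
      M * ‖(be w - t w) • f - ((be w - t w) * al w) • v0‖ := by fun_prop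
    refine (c.tendsto v).eventually (gt_mem_nhds ?_)
    simp [Y0, t0, al0, be0, hρ0]
  filter_upwards [E1, E2, E3] with w C1 C2 C3 hw
  have hww := DD_null S hw
  have h0w := hw.1
  have hv0 : bForm p q v v0 = 1 := by rw [bF_comm, h0v]
  have hfe : bForm p q f e = 1 := by rw [bF_comm, hef]
  have hXw : X w = w - v - bForm p q w v • v0 := by rw [hX]
  have halw : bForm p q f (X w) = al w := by rw [hal, bF_comm]
  have hbew : bForm p q e (X w) = be w := by rw [hbe, bF_comm]
  have hYw : Y w = X w - al w • e - be w • f := by rw [hY]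
  have h0X : bForm p q v0 (X w) = 0 := by
    rw [hXw]; simp only [bF_sub_right, bF_smul_right, h0w, h0v, h00]; ring
  have hvX : bForm p q v (X w) = 0 := by
    rw [hXw]; simp only [bF_sub_right, bF_smul_right, hvv, hv0, bF_comm v w]; ring
  have hXX : bForm p q (X w) (X w) = - 2 * bForm p q w v := by
    rw [hXw]
    simp only [bF_sub_right, bF_smul_right, bF_sub_left, bF_smul_left, hvv, hv0, h0v, h00, hww,
      h0w, bF_comm v w, bF_comm w v0]
    ring
  have hYY : bForm p q (Y w) (Y w) = -2 * bForm p q w v - 2 * (al w * be w) := by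
    rw [hYw]
    simp only [bF_sub_right, bF_smul_right, bF_sub_left, bF_smul_left, hXX, halw, hbew,
      bF_comm (X w) e, bF_comm (X w) f, hee, hff, hef, hfe]
    ring
  have htw : bForm p q (Y w) (Y w) + 2 * s * t w = 0 := by
    rw [ht]; field_simp; ring
  obtain ⟨c, hc, hr⟩ := three_steps (Ω := Ω) (v0 := v0) (v := v) (e := e) (f := f) (y := Y w)
    (be := be w) hM hρ h00 h0v hvv h0e h0f hve hvf hee hff hef
    (by rw [hYw]; simp only [bF_sub_right, bF_smul_right, h0X, h0e, h0f]; ring)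
    (by rw [hYw]; simp only [bF_sub_right, bF_smul_right, hvX, hve, hvf]; ring)
    (by rw [hYw]; simp only [bF_sub_right, bF_smul_right, hbew, hee, hef]; ring)
    (by rw [hYw]; simp only [bF_sub_right, bF_smul_right, halw, hfe, hff]; ring)
    htw C1 C2 C3
  refine ⟨c, by linarith, ?_⟩
  convert hr using 2
  have hlam : bForm p q w v = -((al w - s) * t w + (be w - t w) * al w) := by linarith
  rw [hYw, hXw, hlam]
  module

lemma markowitz_reach {Ω : Set (ℙ ℝ EE)} {x y z : ℙ ℝ EE} {c : ℝ} (h : Reach Ω y z c) :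
    markowitz (bForm p q) Ω x z ≤ markowitz (bForm p q) Ω x y + ENNReal.ofReal c := by
  conv_rhs => rw [markowitz, ENNReal.sInf_add]
  refine le_iInf₂ fun b hb => ?_
  obtain ⟨N, c', hN, hch, rfl⟩ := hb
  obtain ⟨N', hN', hch'⟩ := chain_append_reach hN hch h
  refine le_trans (sInf_le ⟨N', _, hN', hch', rfl⟩) ENNReal.ofReal_add_le

end MarkowitzProper

/-- On a proper quasi-homogeneous domain, the Markowitz distance is a
proper metric: closed balls are compact. -/
theorem stmt_9 (p q : ℕ) (hp : 1 ≤ p) (hq : 1 ≤ q)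
    (Ω : Set (ℙ ℝ (Fin (p + q + 2) → ℝ)))
    (hΩ : IsProperDomain (bForm p q) Ω)
    (hqh : IsQuasiHomogeneous (bForm p q) Ω) :
    ∀ x ∈ Ω, ∀ r : ℝ, 0 ≤ r →
      IsCompact {y | y ∈ Ω ∧ markowitz (bForm p q) Ω x y ≤ ENNReal.ofReal r} := by
  intro x hx r hr
  obtain ⟨v0, S⟩ := setting_of_proper hΩ
  obtain ⟨L, hL, hLD, hreach⟩ := reach_compact S hqh hx (r + 1)
  have hcl : IsClosed {w | w ∈ L ∧ markowitz (bForm p q) Ω x (pr w) ≤ ENNReal.ofReal r} := by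
    refine isClosed_of_closure_subset fun v hv => ?_
    have hvL : v ∈ L := hL.isClosed.closure_subset_iff.mpr (fun w hw => hw.1) hv
    refine ⟨hvL, ENNReal.le_of_forall_pos_le_add fun η hη _ => ?_⟩
    have hloc := local_chain hp hq S (hLD hvL) (η := (η : ℝ)) (by exact_mod_cast hη)
    obtain ⟨w, hw, hwS⟩ := ((mem_closure_iff_frequently.mp hv).and_eventually hloc).exists
    obtain ⟨c, hc, hrc⟩ := hwS (hLD hw.1)
    refine (markowitz_reach hrc).trans (add_le_add hw.2 ?_)
    rw [← ENNReal.ofReal_coe_nnreal]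
    exact ENNReal.ofReal_le_ofReal hc
  have hcomp : IsCompact {w | w ∈ L ∧ markowitz (bForm p q) Ω x (pr w) ≤ ENNReal.ofReal r} :=
    hL.of_isClosed_subset hcl fun w hw => hw.1
  have himg := hcomp.image_of_continuousOn
    (pr_cont.mono fun w hw => ne_of_one (hLD hw.1).1)
  convert himg using 1
  ext y
  constructor
  · rintro ⟨hy, hm⟩
    have hlt : markowitz (bForm p q) Ω x y < ENNReal.ofReal (r + 1) :=
      lt_of_le_of_lt hm ((ENNReal.ofReal_lt_ofReal_iff (by linarith)).mpr (by linarith))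
    obtain ⟨_, ⟨N, c, -, hch, rfl⟩, hc⟩ := sInf_lt_iff.mp hlt
    have hc' : c < r + 1 := (ENNReal.ofReal_lt_ofReal_iff (by linarith)).mp hc
    refine ⟨phi v0 y, ⟨hreach y c (reach_of_chain N hch) hc'.le, ?_⟩, pr_phi S hy⟩
    rwa [pr_phi S hy]
  · rintro ⟨w, hw, rfl⟩
    exact ⟨(hLD hw.1).2, hw.2⟩
end
end

section
/- Let p, q ≥ 1, let Ω be a proper dually convex domain of Ein^{p,q}, and let 𝒦 ⊆ Ω be a compact subset. Then there exist N ∈ ℕ (N ≥ 1) and M > 0 such that δ^Ω_N(x, y) ≤ M for all x, y ∈ 𝒦. -/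
noncomputable section

open scoped LinearAlgebra.Projectivization ENNReal
open Projectivization Filter Topology Set

variable {W : Type} [AddCommGroup W] [Module ℝ W] [TopologicalSpace W]

section Aux

variable {p q : ℕ}

lemma bf_add_left (u v w : Fin (p + q + 2) → ℝ) :
    bForm p q (u + v) w = bForm p q u w + bForm p q v w := by
  simp only [bForm, ← Finset.sum_add_distrib]
  refine Finset.sum_congr rfl fun i _ => ?_
  simp only [Pi.add_apply]; ring

lemma bf_smul_left (c : ℝ) (v w : Fin (p + q + 2) → ℝ) :
    bForm p q (c • v) w = c * bForm p q v w := by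
  simp only [bForm, Finset.mul_sum]
  refine Finset.sum_congr rfl fun i _ => ?_
  simp only [Pi.smul_apply, smul_eq_mul]; ring

lemma bf_comm (v w : Fin (p + q + 2) → ℝ) : bForm p q v w = bForm p q w v := by
  simp only [bForm]
  refine Finset.sum_congr rfl fun i _ => ?_
  ring

lemma bf_add_right (u v w : Fin (p + q + 2) → ℝ) :
    bForm p q w (u + v) = bForm p q w u + bForm p q w v := by
  rw [bf_comm, bf_add_left, bf_comm u, bf_comm v]

lemma bf_smul_right (c : ℝ) (v w : Fin (p + q + 2) → ℝ) :
    bForm p q w (c • v) = c * bForm p q w v := by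
  rw [bf_comm, bf_smul_left, bf_comm v]

lemma bf_sub_left (u v w : Fin (p + q + 2) → ℝ) :
    bForm p q (u - v) w = bForm p q u w - bForm p q v w := by
  have h := bf_smul_left (-1) v w
  rw [sub_eq_add_neg, bf_add_left, ← neg_one_smul ℝ v, h]; ring

lemma bf_sub_right (u v w : Fin (p + q + 2) → ℝ) :
    bForm p q w (u - v) = bForm p q w u - bForm p q w v := by
  rw [bf_comm, bf_sub_left, bf_comm u, bf_comm v]

lemma bf_cont : Continuous fun x : (Fin (p + q + 2) → ℝ) × (Fin (p + q + 2) → ℝ) =>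
    bForm p q x.1 x.2 := by
  unfold bForm; fun_prop

/-- the sign flip -/
def sg (p q : ℕ) (v : Fin (p + q + 2) → ℝ) : Fin (p + q + 2) → ℝ :=
  fun i => (if (i : ℕ) ≤ p then (-1 : ℝ) else 1) * v i

lemma sg_sg (v : Fin (p + q + 2) → ℝ) : sg p q (sg p q v) = v := by
  funext i; simp only [sg]; split_ifs <;> ring

lemma bf_sg (v w : Fin (p + q + 2) → ℝ) : bForm p q v (sg p q w) = ∑ i, v i * w i := by
  simp only [bForm, sg]
  refine Finset.sum_congr rfl fun i _ => ?_
  split_ifs <;> ring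

lemma bf_sg_sg (v w : Fin (p + q + 2) → ℝ) :
    bForm p q (sg p q v) (sg p q w) = bForm p q v w := by
  simp only [bForm, sg]
  refine Finset.sum_congr rfl fun i _ => ?_
  split_ifs <;> ring

lemma bf_sg_left (v w : Fin (p + q + 2) → ℝ) :
    bForm p q (sg p q v) w = bForm p q v (sg p q w) := by
  rw [← bf_sg_sg, sg_sg]

lemma sg_cont : Continuous (sg p q) := by unfold sg; fun_prop

lemma bf_le (w : Fin (p + q + 2) → ℝ) : bForm p q w w ≤ bForm p q w (sg p q w) := by
  rw [bf_sg]; unfold bForm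
  refine Finset.sum_le_sum fun i _ => ?_
  split_ifs <;> nlinarith [sq_nonneg (w i)]

lemma neg_bf_le (w : Fin (p + q + 2) → ℝ) : -bForm p q w w ≤ bForm p q w (sg p q w) := by
  rw [bf_sg]; unfold bForm; rw [← Finset.sum_neg_distrib]
  refine Finset.sum_le_sum fun i _ => ?_
  split_ifs <;> nlinarith [sq_nonneg (w i)]

lemma bf_sg_pos {v : Fin (p + q + 2) → ℝ} (hv : v ≠ 0) : 0 < bForm p q v (sg p q v) := by
  rw [bf_sg]
  obtain ⟨i, hi⟩ := Function.ne_iff.mp hv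
  refine Finset.sum_pos' (fun i _ => mul_self_nonneg _) ⟨i, Finset.mem_univ _, ?_⟩
  exact mul_self_pos.mpr hi

/-- two distinct indices carry a nonzero vector Euclid-orthogonal to `v` -/
lemma exists_two (v : Fin (p + q + 2) → ℝ) (i j : Fin (p + q + 2)) (hij : i ≠ j) :
    ∃ e : Fin (p + q + 2) → ℝ, e ≠ 0 ∧ ∑ k, e k * v k = 0 ∧
      ∀ k, k ≠ i → k ≠ j → e k = 0 := by
  by_cases h : v i = 0
  · refine ⟨Pi.single i 1, ?_, ?_, ?_⟩
    · simp
    · simp [Pi.single_apply, h]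
    · intro k hk _; simp [hk]
  · refine ⟨v i • Pi.single j 1 - v j • Pi.single i 1, ?_, ?_, ?_⟩
    · intro h0
      have := congrFun h0 j
      simp [hij.symm] at this
      exact h this
    · simp [sub_mul, Finset.sum_sub_distrib, Pi.single_apply]; ring
    · intro k hk hk'; simp [hk, hk']

lemma exists_e (hp : 1 ≤ p) (v : Fin (p + q + 2) → ℝ) :
    ∃ e : Fin (p + q + 2) → ℝ, sg p q e = -e ∧ bForm p q e v = 0 ∧ bForm p q e e = -1 := by
  obtain ⟨e, h0, h1, h2⟩ := exists_two (sg p q (sg p q v)) ⟨0, by omega⟩ ⟨1, by omega⟩ (by simp)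
  have hs : sg p q e = -e := by
    funext k
    simp only [sg, Pi.neg_apply]
    split_ifs with h
    · ring
    · rw [h2 k (by rintro rfl; simp at h) (by rintro rfl; simp at h; omega)]; ring
  have hpos := bf_sg_pos h0
  have hpos' : bForm p q e (sg p q e) = - bForm p q e e := by
    rw [hs, ← neg_one_smul ℝ e, bf_smul_right]; ring
  have hv : bForm p q e v = 0 := by
    rw [← bf_sg, sg_sg] at h1
    have : bForm p q e (sg p q v) = - bForm p q e v := by
      rw [← bf_sg_left, hs, ← neg_one_smul ℝ e, bf_smul_left]; ring
    linarith
  set k := bForm p q e (sg p q e)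
  refine ⟨(Real.sqrt k)⁻¹ • e, ?_, ?_, ?_⟩
  · have : sg p q ((Real.sqrt k)⁻¹ • e) = (Real.sqrt k)⁻¹ • sg p q e := by
      funext i; simp [sg]
    rw [this, hs, smul_neg]
  · rw [bf_smul_left, hv, mul_zero]
  · rw [bf_smul_left, bf_smul_right, ← mul_assoc, ← mul_inv, Real.mul_self_sqrt hpos.le]
    rw [show bForm p q e e = -k by linarith]; field_simp

lemma exists_f (hq : 1 ≤ q) (v : Fin (p + q + 2) → ℝ) :
    ∃ e : Fin (p + q + 2) → ℝ, sg p q e = e ∧ bForm p q e v = 0 ∧ bForm p q e e = 1 := by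
  obtain ⟨e, h0, h1, h2⟩ := exists_two (sg p q (sg p q v)) ⟨p + 1, by omega⟩ ⟨p + 2, by omega⟩
    (by simp)
  have hs : sg p q e = e := by
    funext k
    simp only [sg]
    split_ifs with h
    · rw [h2 k (by rintro rfl; simp at h) (by rintro rfl; simp at h)]; ring
    · ring
  have hpos := bf_sg_pos h0
  have hv : bForm p q e v = 0 := by
    rw [← bf_sg, sg_sg] at h1
    rw [← bf_sg_left, hs] at h1
    exact h1
  rw [hs] at hpos
  set k := bForm p q e e with hk
  refine ⟨(Real.sqrt k)⁻¹ • e, ?_, ?_, ?_⟩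
  · have : sg p q ((Real.sqrt k)⁻¹ • e) = (Real.sqrt k)⁻¹ • sg p q e := by
      funext i; simp [sg]; 
    rw [this, hs]
  · rw [bf_smul_left, hv, mul_zero]
  · rw [bf_smul_left, bf_smul_right, ← mul_assoc, ← mul_inv, Real.mul_self_sqrt hpos.le]
    rw [← hk]; field_simp

/-- conformal chart at `v` -/
def Phi (p q : ℕ) (v w : Fin (p + q + 2) → ℝ) : Fin (p + q + 2) → ℝ :=
  v + w - (bForm p q w w / (2 * bForm p q v (sg p q v))) • sg p q v

lemma Phi_zero (v : Fin (p + q + 2) → ℝ) : Phi p q v 0 = v := by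
  have : bForm p q (0 : Fin (p + q + 2) → ℝ) 0 = 0 := by simp [bForm]
  simp [Phi, this]

lemma Phi_pair {v w w' : Fin (p + q + 2) → ℝ} (hv : v ≠ 0) (hQ : bForm p q v v = 0)
    (h1 : bForm p q w v = 0) (h2 : bForm p q w (sg p q v) = 0)
    (h1' : bForm p q w' v = 0) (h2' : bForm p q w' (sg p q v) = 0)
    (h : bForm p q (w - w') (w - w') = 0) :
    bForm p q (Phi p q v w) (Phi p q v w') = 0 := by
  have hk := bf_sg_pos hv
  have hQ' : bForm p q (sg p q v) (sg p q v) = 0 := by rw [bf_sg_sg, hQ]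
  simp only [Phi, bf_add_left, bf_add_right, bf_sub_left, bf_sub_right, bf_smul_left,
    bf_smul_right] at h ⊢
  rw [bf_comm v w', bf_comm (sg p q v) w', bf_comm (sg p q v) v]
  rw [bf_comm w' w] at h
  rw [h1, h2, h1', h2', hQ, hQ']
  field_simp
  linear_combination (-2 * bForm p q v (sg p q v) ^ 2) * h

lemma Phi_slice {v w : Fin (p + q + 2) → ℝ} (hQ : bForm p q v v = 0)
    (h2 : bForm p q w (sg p q v) = 0) :
    bForm p q (Phi p q v w) (sg p q v) = bForm p q v (sg p q v) := by
  have hQ' : bForm p q (sg p q v) (sg p q v) = 0 := by rw [bf_sg_sg, hQ]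
  simp only [Phi, bf_add_left, bf_sub_left, bf_smul_left, h2, hQ']
  ring

lemma Phi_cont (v : Fin (p + q + 2) → ℝ) : Continuous (Phi p q v) := by
  unfold Phi bForm; fun_prop

/-- membership in a small piece of the null cone, normalised -/
def Sl (p q : ℕ) (ε : ℝ) (v z : Fin (p + q + 2) → ℝ) : Prop :=
  bForm p q z z = 0 ∧ bForm p q z (sg p q v) = bForm p q v (sg p q v) ∧ ‖z - v‖ < ε

lemma Sl_Phi {ε : ℝ} {v w : Fin (p + q + 2) → ℝ} (hv : v ≠ 0) (hQ : bForm p q v v = 0)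
    (h1 : bForm p q w v = 0) (h2 : bForm p q w (sg p q v) = 0) (h : ‖Phi p q v w - v‖ < ε) :
    Sl p q ε v (Phi p q v w) :=
  ⟨Phi_pair hv hQ h1 h2 h1 h2 (by simp [bForm]), Phi_slice hQ h2, h⟩

/-- a second point in the slice, joined to `v` -/
lemma exists_other (hp : 1 ≤ p) (hq : 1 ≤ q) {v : Fin (p + q + 2) → ℝ} (hv : v ≠ 0)
    (hQ : bForm p q v v = 0) {ε : ℝ} (hε : 0 < ε) :
    ∃ z, z ≠ v ∧ Sl p q ε v z ∧ bForm p q v z = 0 := by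
  obtain ⟨e, he, hev, hee⟩ := exists_e (q := q) hp v
  obtain ⟨f, hf, hfv, hff⟩ := exists_f (p := p) hq v
  have hef : bForm p q e f = 0 := by
    have := bf_sg_left e f
    rw [he, hf, ← neg_one_smul ℝ e, bf_smul_left] at this
    linarith
  have hev' : bForm p q e (sg p q v) = 0 := by
    rw [← bf_sg_left, he, ← neg_one_smul ℝ e, bf_smul_left, hev, mul_zero]
  have hfv' : bForm p q f (sg p q v) = 0 := by
    rw [← bf_sg_left, hf, hfv]
  have hnull : ∀ t : ℝ, bForm p q (t • (e + f)) (t • (e + f)) = 0 := by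
    intro t
    simp only [bf_add_left, bf_add_right, bf_smul_left, bf_smul_right, bf_comm f e, hef, hee, hff]
    ring
  have hc : ∀ᶠ t in 𝓝[≠] (0 : ℝ), ‖Phi p q v (t • (e + f)) - v‖ < ε := by
    have hc : Continuous fun t : ℝ => ‖Phi p q v (t • (e + f)) - v‖ := by
      have := Phi_cont (p := p) (q := q) v
      fun_prop
    have := hc.tendsto 0
    simp only [zero_smul, Phi_zero, sub_self, norm_zero] at this
    exact (this.eventually (gt_mem_nhds hε)).filter_mono nhdsWithin_le_nhds
  obtain ⟨t, ht, ht0⟩ := (hc.and self_mem_nhdsWithin).exists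
  have ht0 : t ≠ 0 := ht0
  have g1 : bForm p q (t • (e + f)) v = 0 := by simp [bf_add_left, bf_smul_left, hev, hfv]
  have g2 : bForm p q (t • (e + f)) (sg p q v) = 0 := by
    simp [bf_add_left, bf_smul_left, hev', hfv']
  refine ⟨Phi p q v (t • (e + f)), ?_, Sl_Phi hv hQ g1 g2 ht, ?_⟩
  · intro h
    have h3 : bForm p q (Phi p q v (t • (e + f))) f = t := by
      simp only [Phi, hnull, bf_sub_left, bf_add_left, bf_smul_left, bf_comm v f, hfv, hef, hff]
      ring
    rw [h, bf_comm, hfv] at h3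
    exact ht0 h3.symm
  · have := Phi_pair (w := 0) (w' := t • (e + f)) hv hQ (by simp [bForm]) (by simp [bForm]) g1 g2
      (by rw [zero_sub, ← smul_neg, ← neg_one_smul ℝ (e + f), smul_smul]; exact hnull _)
    rwa [Phi_zero] at this

lemma local_vec (hp : 1 ≤ p) (hq : 1 ≤ q) {v : Fin (p + q + 2) → ℝ} (hv : v ≠ 0)
    (hQ : bForm p q v v = 0) {ε : ℝ} (hε : 0 < ε) :
    ∀ᶠ z in 𝓝 v, bForm p q z z = 0 → ∃ (c : ℝ) (z1 z2 z3 : Fin (p + q + 2) → ℝ), c ≠ 0 ∧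
      Sl p q ε v z1 ∧ Sl p q ε v z2 ∧ Sl p q ε v z3 ∧ Sl p q ε v (c • z) ∧
      bForm p q v z1 = 0 ∧ bForm p q z1 z2 = 0 ∧ bForm p q z2 z3 = 0 ∧
      bForm p q z3 (c • z) = 0 := by
  obtain ⟨e, he, hev, hee⟩ := exists_e (q := q) hp v
  obtain ⟨f, hf, hfv, hff⟩ := exists_f (p := p) hq v
  have hk := bf_sg_pos hv
  have hev' : bForm p q e (sg p q v) = 0 := by
    rw [← bf_sg_left, he, ← neg_one_smul ℝ e, bf_smul_left, hev, mul_zero]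
  have hfv' : bForm p q f (sg p q v) = 0 := by
    rw [← bf_sg_left, hf, hfv]
  have hQ' : bForm p q (sg p q v) (sg p q v) = 0 := by rw [bf_sg_sg, hQ]
  set k := bForm p q v (sg p q v) with hkdef
  let C : (Fin (p + q + 2) → ℝ) → ℝ := fun z => k / bForm p q z (sg p q v)
  let w : (Fin (p + q + 2) → ℝ) → (Fin (p + q + 2) → ℝ) := fun z =>
    C z • z - v - (bForm p q (C z • z) v / k) • sg p q v
  have wv : w v = 0 := by
    have : C v = 1 := by simp only [C, ← hkdef]; field_simp
    simp [w, this, hQ]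
  let wm : (Fin (p + q + 2) → ℝ) → (Fin (p + q + 2) → ℝ) := fun w => (1 / 2 : ℝ) • (w - sg p q w)
  let wp : (Fin (p + q + 2) → ℝ) → (Fin (p + q + 2) → ℝ) := fun w => (1 / 2 : ℝ) • (w + sg p q w)
  let r : (Fin (p + q + 2) → ℝ) → ℝ := fun w => Real.sqrt (-bForm p q (wm w) (wm w))
  let s : (Fin (p + q + 2) → ℝ) → ℝ := fun w => Real.sqrt (bForm p q (wp w) (wp w))
  let n1 : (Fin (p + q + 2) → ℝ) → (Fin (p + q + 2) → ℝ) := fun w => (1 / 2 : ℝ) • (wm w + r w • f)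
  let n3 : (Fin (p + q + 2) → ℝ) → (Fin (p + q + 2) → ℝ) := fun w =>
    wm w + (1 / 2 : ℝ) • (wp w + s w • e)
  have cb : ∀ g : (Fin (p + q + 2) → ℝ) → (Fin (p + q + 2) → ℝ), Continuous g →
      Continuous fun w => bForm p q (g w) (g w) := fun g hg => bf_cont.comp (hg.prodMk hg)
  have cs := sg_cont (p := p) (q := q)
  have cwm : Continuous wm := by simp only [wm]; fun_prop
  have cwp : Continuous wp := by simp only [wp]; fun_prop
  have cr : Continuous r := by
    have := cb _ cwm
    simp only [r]; fun_prop
  have css : Continuous s := by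
    have := cb _ cwp
    simp only [s]; fun_prop
  have cn1 : Continuous n1 := by simp only [n1]; fun_prop
  have cn3 : Continuous n3 := by simp only [n3]; fun_prop
  have sg0 : sg p q 0 = 0 := by funext i; simp [sg]
  have b0 : bForm p q (0 : Fin (p + q + 2) → ℝ) 0 = 0 := by simp [bForm]
  have wm0 : wm 0 = 0 := by simp [wm, sg0]
  have wp0 : wp 0 = 0 := by simp [wp, sg0]
  have n10 : n1 0 = 0 := by simp [n1, r, wm0, b0]
  have n30 : n3 0 = 0 := by simp [n3, s, wm0, wp0, b0]
  have cC : ContinuousAt C v := by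
    have h : Continuous fun z => bForm p q z (sg p q v) :=
      bf_cont.comp (continuous_id.prodMk continuous_const)
    exact ContinuousAt.div continuousAt_const h.continuousAt hk.ne'
  have cw : ContinuousAt w v := by
    have h1 : ContinuousAt (fun z => C z • z) v := cC.smul continuousAt_id
    have h : Continuous fun z => bForm p q z v :=
      bf_cont.comp (continuous_id.prodMk continuous_const)
    have h2 : ContinuousAt (fun z => bForm p q (C z • z) v) v :=
      ContinuousAt.comp (g := fun z => bForm p q z v) h.continuousAt h1
    exact (h1.sub continuousAt_const).sub ((h2.div_const _).smul continuousAt_const)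
  have small : ∀ g : (Fin (p + q + 2) → ℝ) → (Fin (p + q + 2) → ℝ), Continuous g → g 0 = 0 →
      ∀ᶠ z in 𝓝 v, ‖Phi p q v (g (w z)) - v‖ < ε := by
    intro g hg g0
    have hc : Continuous fun w => ‖Phi p q v (g w) - v‖ := by
      have := Phi_cont (p := p) (q := q) v
      fun_prop
    have hc2 : ContinuousAt (fun z => ‖Phi p q v (g (w z)) - v‖) v :=
      ContinuousAt.comp (g := fun w => ‖Phi p q v (g w) - v‖) hc.continuousAt cw
    have h3 : Tendsto (fun z => ‖Phi p q v (g (w z)) - v‖) (𝓝 v) (𝓝 0) := by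
      have := hc2.tendsto
      simpa only [wv, g0, Phi_zero, sub_self, norm_zero] using this
    exact h3.eventually (gt_mem_nhds hε)
  have hne : ∀ᶠ z in 𝓝 v, bForm p q z (sg p q v) ≠ 0 := by
    have h : Continuous fun z => bForm p q z (sg p q v) :=
      bf_cont.comp (continuous_id.prodMk continuous_const)
    exact h.continuousAt.eventually_ne hk.ne'
  filter_upwards [small n1 cn1 n10, small wm cwm wm0, small n3 cn3 n30, small id continuous_id rfl,
    hne] with z s1 s2 s3 s4 hz hz0
  simp only [id] at s4
  have hC : C z ≠ 0 := div_ne_zero hk.ne' hz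
  have hCz : bForm p q (C z • z) (sg p q v) = k := by
    rw [bf_smul_left]; simp only [C]; field_simp
  have hCz0 : bForm p q (C z • z) (C z • z) = 0 := by
    rw [bf_smul_left, bf_smul_right, hz0]; ring
  have hw1 : bForm p q (w z) v = 0 := by
    simp only [w, bf_sub_left, bf_smul_left]
    rw [bf_comm (sg p q v) v, hQ, ← hkdef, div_mul_cancel₀ _ hk.ne']
    ring
  have hw2 : bForm p q (w z) (sg p q v) = 0 := by
    simp only [w, bf_sub_left]
    rw [hCz, bf_smul_left _ (sg p q v), hQ', ← hkdef]
    ring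
  have hF : Phi p q v (w z) = C z • z := by
    have hz' : C z • z = v + w z + (bForm p q (C z • z) v / k) • sg p q v := by
      simp only [w]; abel
    generalize bForm p q (C z • z) v / k = c at hz'
    have h5 := hCz0
    rw [hz'] at h5
    simp only [bf_add_left, bf_add_right, bf_smul_left, bf_smul_right, hw1, hw2, hQ, hQ',
      bf_comm v (w z), bf_comm (sg p q v) (w z), bf_comm (sg p q v) v, ← hkdef] at h5
    have h6 : c = -(bForm p q (w z) (w z) / (2 * k)) := by
      field_simp; linarith
    rw [hz', h6, Phi, ← hkdef, neg_smul, sub_eq_add_neg]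
  generalize w z = W at *
  have hsW1 : bForm p q (sg p q W) v = 0 := by rw [bf_sg_left, hw2]
  have hsW2 : bForm p q (sg p q W) (sg p q v) = 0 := by rw [bf_sg_sg, hw1]
  have hm1 : bForm p q (wm W) v = 0 := by simp [wm, bf_smul_left, bf_sub_left, hw1, hsW1]
  have hm2 : bForm p q (wm W) (sg p q v) = 0 := by simp [wm, bf_smul_left, bf_sub_left, hw2, hsW2]
  have hp1 : bForm p q (wp W) v = 0 := by simp [wp, bf_smul_left, bf_add_left, hw1, hsW1]
  have hp2 : bForm p q (wp W) (sg p q v) = 0 := by simp [wp, bf_smul_left, bf_add_left, hw2, hsW2]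
  have hfm : bForm p q (wm W) f = 0 := by
    simp only [wm, bf_smul_left, bf_sub_left]
    rw [bf_sg_left, hf]; ring
  have hep : bForm p q (wp W) e = 0 := by
    simp only [wp, bf_smul_left, bf_add_left]
    rw [bf_sg_left, he, ← neg_one_smul ℝ e, bf_smul_right]; ring
  have hr : r W * r W = -bForm p q (wm W) (wm W) := by
    refine Real.mul_self_sqrt ?_
    simp only [wm, bf_smul_left, bf_smul_right, bf_sub_left, bf_sub_right]
    rw [bf_sg_sg, bf_comm (sg p q W) W]
    have := bf_le W
    linarith
  have hs : s W * s W = bForm p q (wp W) (wp W) := by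
    refine Real.mul_self_sqrt ?_
    simp only [wp, bf_smul_left, bf_smul_right, bf_add_left, bf_add_right]
    rw [bf_sg_sg, bf_comm (sg p q W) W]
    have := neg_bf_le W
    linarith
  have hsum : W = wm W + wp W := by
    simp only [wm, wp]; module
  have h11 : bForm p q (n1 W) v = 0 := by simp [n1, bf_smul_left, bf_add_left, hm1, hfv]
  have h12 : bForm p q (n1 W) (sg p q v) = 0 := by simp [n1, bf_smul_left, bf_add_left, hm2, hfv']
  have h31 : bForm p q (n3 W) v = 0 := by
    simp [n3, bf_smul_left, bf_add_left, hm1, hp1, hev]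
  have h32 : bForm p q (n3 W) (sg p q v) = 0 := by
    simp [n3, bf_smul_left, bf_add_left, hm2, hp2, hev']
  have nullm : ∀ t : ℝ, t * t = 1 → bForm p q ((1 / 2 : ℝ) • (wm W + (t * r W) • f))
      ((1 / 2 : ℝ) • (wm W + (t * r W) • f)) = 0 := by
    intro t ht
    simp only [bf_smul_left, bf_smul_right, bf_add_left, bf_add_right, hfm, bf_comm f (wm W), hff]
    linear_combination (1 / 4 : ℝ) * r W * r W * ht + (1 / 4 : ℝ) * hr
  have nullp : ∀ t : ℝ, t * t = 1 → bForm p q ((1 / 2 : ℝ) • (wp W + (t * s W) • e))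
      ((1 / 2 : ℝ) • (wp W + (t * s W) • e)) = 0 := by
    intro t ht
    simp only [bf_smul_left, bf_smul_right, bf_add_left, bf_add_right, hep, bf_comm e (wp W), hee]
    linear_combination -(1 / 4 : ℝ) * s W * s W * ht - (1 / 4 : ℝ) * hs
  have negb : ∀ a : Fin (p + q + 2) → ℝ, bForm p q a a = 0 → bForm p q (-a) (-a) = 0 := by
    intro a ha
    rw [← neg_one_smul ℝ a, bf_smul_left, bf_smul_right, ha]; ring
  refine ⟨C z, Phi p q v (n1 W), Phi p q v (wm W), Phi p q v (n3 W), hC, ?_⟩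
  rw [← hF]
  refine ⟨Sl_Phi hv hQ h11 h12 s1, Sl_Phi hv hQ hm1 hm2 s2, Sl_Phi hv hQ h31 h32 s3,
    Sl_Phi hv hQ hw1 hw2 s4, ?_, ?_, ?_, ?_⟩
  · have := Phi_pair (w := 0) (w' := n1 W) hv hQ (by simp [bForm]) (by simp [bForm]) h11 h12 (by
      rw [zero_sub]
      refine negb _ ?_
      have := nullm 1 (by norm_num)
      rwa [one_mul] at this)
    rwa [Phi_zero] at this
  · refine Phi_pair hv hQ h11 h12 hm1 hm2 ?_
    have : n1 W - wm W = -((1 / 2 : ℝ) • (wm W + (-1 * r W) • f)) := by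
      simp only [n1]; module
    rw [this]
    exact negb _ (nullm (-1) (by norm_num))
  · refine Phi_pair hv hQ hm1 hm2 h31 h32 ?_
    have : wm W - n3 W = -((1 / 2 : ℝ) • (wp W + (1 * s W) • e)) := by
      simp only [n3]; module
    rw [this]
    exact negb _ (nullp 1 (by norm_num))
  · refine Phi_pair hv hQ h31 h32 hw1 hw2 ?_
    have : n3 W - W = -((1 / 2 : ℝ) • (wp W + (-1 * s W) • e)) := by
      nth_rewrite 2 [hsum]
      simp only [n3]; module
    rw [this]
    exact negb _ (nullp (-1) (by norm_num))

/-- a single step of cost at most two -/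
def Stp (p q : ℕ) (Ω : Set (ℙ ℝ (Fin (p + q + 2) → ℝ))) (x y : ℙ ℝ (Fin (p + q + 2) → ℝ)) :
    Prop :=
  ∃ (α : ℝ → ℙ ℝ (Fin (p + q + 2) → ℝ)) (s t : ℝ), IsLightGeodesic (bForm p q) Ω α ∧
    s ∈ II ∧ t ∈ II ∧ α s = x ∧ α t = y ∧ dHyp s t ≤ 2

lemma dHyp_comm {s t : ℝ} : dHyp s t = dHyp t s := by
  unfold dHyp
  rw [← abs_neg, ← Real.log_inv, inv_div]
  congr 3 <;> ring

lemma Stp.symm {Ω : Set (ℙ ℝ (Fin (p + q + 2) → ℝ))} {x y : ℙ ℝ (Fin (p + q + 2) → ℝ)}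
    (h : Stp p q Ω x y) : Stp p q Ω y x := by
  obtain ⟨α, s, t, h1, h2, h3, h4, h5, h6⟩ := h
  exact ⟨α, t, s, h1, h3, h2, h5, h4, by rwa [dHyp_comm]⟩

lemma geod {Ω : Set (ℙ ℝ (Fin (p + q + 2) → ℝ))} {v z0 z1 : Fin (p + q + 2) → ℝ} {ε : ℝ}
    (hv : v ≠ 0)
    (H : ∀ z, bForm p q z z = 0 → ‖z - v‖ < 5 * ε → ∃ h : z ≠ 0, mk ℝ z h ∈ Ω)
    (h0 : Sl p q ε v z0) (h1 : Sl p q ε v z1) (h01 : bForm p q z0 z1 = 0) (hne : z0 ≠ z1)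
    (hz0 : z0 ≠ 0) (hz1 : z1 ≠ 0) :
    ∃ α, IsLightGeodesic (bForm p q) Ω α ∧ α 0 = mk ℝ z0 hz0 ∧ α (1 / 2) = mk ℝ z1 hz1 := by
  classical
  obtain ⟨a1, a2, a3⟩ := h0
  obtain ⟨b1, b2, b3⟩ := h1
  have hk := bf_sg_pos hv
  let g : ℝ → (Fin (p + q + 2) → ℝ) := fun t => (0 * t + 1) • z0 + (2 * t + 0) • (z1 - z0)
  have hg0 : g 0 = z0 := by simp [g]
  have hg1 : g (1 / 2) = z1 := by simp [g]
  have hgn : ∀ t, bForm p q (g t) (g t) = 0 := by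
    intro t
    simp only [g, bf_add_left, bf_add_right, bf_smul_left, bf_smul_right, bf_sub_left,
      bf_sub_right, a1, b1, h01, bf_comm z1 z0]
    ring
  have hgd : ∀ t ∈ II, ‖g t - v‖ < 5 * ε := by
    intro t ht
    have e1 : g t - v = (z0 - v) + (2 * t) • ((z1 - v) - (z0 - v)) := by
      simp only [g]; module
    have ht' : |t| < 1 := abs_lt.mpr ht
    rw [e1]
    have n1 := norm_add_le (z0 - v) ((2 * t) • ((z1 - v) - (z0 - v)))
    rw [norm_smul, Real.norm_eq_abs, abs_mul, abs_two] at n1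
    have n2 := norm_sub_le (z1 - v) (z0 - v)
    have n3 : 2 * |t| * ‖z1 - v - (z0 - v)‖ ≤ 2 * ‖z1 - v - (z0 - v)‖ := by
      nlinarith [norm_nonneg (z1 - v - (z0 - v))]
    linarith
  let α : ℝ → ℙ ℝ (Fin (p + q + 2) → ℝ) := fun t =>
    if h : g t ≠ 0 then mk ℝ (g t) h else mk ℝ z0 hz0
  have hα : ∀ t (h : g t ≠ 0), α t = mk ℝ (g t) h := by
    intro t h; simp only [α]; rw [dif_pos h]
  refine ⟨α, ⟨z0, z1 - z0, 0, 1, 2, 0, ?_, a1, ?_, ?_, by norm_num, ?_⟩, ?_, ?_⟩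
  · rw [LinearIndependent.pair_iff]
    intro s t hst
    have h3 : bForm p q (s • z0 + t • (z1 - z0)) (sg p q v) = 0 := by rw [hst]; simp [bForm]
    simp only [bf_add_left, bf_smul_left, bf_sub_left, a2, b2, sub_self, mul_zero, add_zero] at h3
    have hs : s = 0 := by
      rcases mul_eq_zero.mp h3 with h | h
      · exact h
      · exact absurd h hk.ne'
    refine ⟨hs, ?_⟩
    rw [hs, zero_smul, zero_add, smul_eq_zero] at hst
    rcases hst with h | h
    · exact h
    · exact absurd (sub_eq_zero.mp h).symm hne
  · rw [bf_sub_right, h01, a1, sub_zero]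
  · simp only [bf_sub_right, bf_sub_left, h01, a1, b1, bf_comm z1 z0]; ring
  · intro t ht
    obtain ⟨h, hm⟩ := H (g t) (hgn t) (hgd t ht)
    exact ⟨h, hα t h, by rw [hα t h]; exact hm⟩
  · rw [hα 0 (by rw [hg0]; exact hz0)]; congr 1
  · rw [hα (1 / 2) (by rw [hg1]; exact hz1)]; congr 1

lemma dHyp_half : dHyp 0 (1 / 2) ≤ 2 := by
  have : dHyp 0 (1 / 2) = |Real.log 3| := by unfold dHyp; norm_num
  rw [this, abs_of_nonneg (Real.log_nonneg (by norm_num))]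
  have := Real.log_le_sub_one_of_pos (show (0 : ℝ) < 3 by norm_num)
  linarith

inductive Ch (p q : ℕ) (Ω : Set (ℙ ℝ (Fin (p + q + 2) → ℝ))) :
    ℕ → ℙ ℝ (Fin (p + q + 2) → ℝ) → ℙ ℝ (Fin (p + q + 2) → ℝ) → Prop
  | refl (x) : Ch p q Ω 0 x x
  | snoc {n x y z} : Ch p q Ω n x y → Stp p q Ω y z → Ch p q Ω (n + 1) x z

section
variable {Ω : Set (ℙ ℝ (Fin (p + q + 2) → ℝ))}

lemma Ch.trans {n m x y z} (h : Ch p q Ω n x y) (h' : Ch p q Ω m y z) : Ch p q Ω (n + m) x z := by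
  induction h' with
  | refl => exact h
  | snoc _ hs ih => exact Ch.snoc (ih h) hs

lemma Ch.symm {n x y} (h : Ch p q Ω n x y) : Ch p q Ω n y x := by
  induction h with
  | refl => exact Ch.refl _
  | @snoc n x y z _ hs ih =>
    have := Ch.trans (Ch.snoc (Ch.refl _) hs.symm) ih
    rwa [zero_add, add_comm] at this

lemma Ch.cost {n x y} (h : Ch p q Ω n x y) :
    ∃ c : ℝ, c ≤ 2 * n ∧ IsChainCost (bForm p q) Ω x y n c := by
  induction h with
  | refl x =>
    exact ⟨0, by simp, fun _ => x, Fin.elim0, Fin.elim0, Fin.elim0, rfl, rfl,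
      fun i => i.elim0, by simp⟩
  | @snoc n x y z _ hs ih =>
    obtain ⟨c, hc, xs, αs, ss, ts, h0, h1, h2, h3⟩ := ih
    obtain ⟨α, s, t, g1, g2, g3, g4, g5, g6⟩ := hs
    refine ⟨c + dHyp s t, by push_cast; linarith, Fin.snoc (α := fun _ => _) xs z,
      Fin.snoc (α := fun _ => _) αs α, Fin.snoc (α := fun _ => _) ss s,
      Fin.snoc (α := fun _ => _) ts t, ?_, ?_, ?_, ?_⟩
    · rw [← h0]
      exact Fin.snoc_castSucc (α := fun _ => _) z xs 0
    · exact Fin.snoc_last (α := fun _ => _) z xs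
    · intro i
      refine Fin.lastCases ?_ (fun j => ?_) i
      · simp only [Fin.snoc_last, Fin.snoc_castSucc, Fin.succ_last]
        exact ⟨g1, g2, g3, by rw [g4, h1], g5⟩
      · simp only [Fin.snoc_castSucc, Fin.succ_castSucc]
        exact h2 j
    · rw [Fin.sum_univ_castSucc]
      simp only [Fin.snoc_castSucc, Fin.snoc_last, h3]

/-- reachability in at most `k` steps -/
def Rk (p q : ℕ) (Ω : Set (ℙ ℝ (Fin (p + q + 2) → ℝ))) (k : ℕ)
    (x y : ℙ ℝ (Fin (p + q + 2) → ℝ)) : Prop := ∃ n ≤ k, Ch p q Ω n x y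

lemma Rk.trans {k l x y z} (h : Rk p q Ω k x y) (h' : Rk p q Ω l y z) : Rk p q Ω (k + l) x z := by
  obtain ⟨n, hn, h⟩ := h
  obtain ⟨m, hm, h'⟩ := h'
  exact ⟨n + m, by omega, h.trans h'⟩

lemma Rk.symm {k x y} (h : Rk p q Ω k x y) : Rk p q Ω k y x := by
  obtain ⟨n, hn, h⟩ := h
  exact ⟨n, hn, h.symm⟩

lemma Rk.mono {k l x y} (hkl : k ≤ l) (h : Rk p q Ω k x y) : Rk p q Ω l x y := by
  obtain ⟨n, hn, h⟩ := h
  exact ⟨n, hn.trans hkl, h⟩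

lemma mem_ein (z : Fin (p + q + 2) → ℝ) (hz : z ≠ 0) :
    mk ℝ z hz ∈ einSet (bForm p q) ↔ bForm p q z z = 0 := by
  obtain ⟨a, ha⟩ := exists_smul_eq_mk_rep ℝ z hz
  simp only [einSet, mem_ofPred_eq, ← ha, Units.smul_def, bf_smul_left, bf_smul_right]
  simp

lemma Sl_ne {ε : ℝ} {v z : Fin (p + q + 2) → ℝ} (hv : v ≠ 0) (h : Sl p q ε v z) : z ≠ 0 := by
  rintro rfl
  have := h.2.1
  have hk := bf_sg_pos hv
  rw [← this] at hk
  simp [bForm] at hk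

lemma near_proj {v : Fin (p + q + 2) → ℝ} (hv : v ≠ 0) {P : (Fin (p + q + 2) → ℝ) → Prop}
    (h : ∀ᶠ z in 𝓝 v, P z) : ∀ᶠ y in 𝓝 (mk ℝ v hv), ∃ z hz, y = mk ℝ z hz ∧ P z := by
  obtain ⟨O, hO, hOo, hvO⟩ := eventually_nhds_iff.mp h
  refine eventually_nhds_iff.mpr ⟨{y | ∃ z hz, y = mk ℝ z hz ∧ z ∈ O}, ?_, ?_, ⟨v, hv, rfl, hvO⟩⟩
  · rintro y ⟨z, hz, rfl, h⟩
    exact ⟨z, hz, rfl, hO z h⟩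
  · have key : IsOpen ((fun z : {v : Fin (p + q + 2) → ℝ // v ≠ 0} => mk ℝ z.1 z.2) ⁻¹'
        {y | ∃ z hz, y = mk ℝ z hz ∧ z ∈ O}) := by
      have : ((fun z : {v : Fin (p + q + 2) → ℝ // v ≠ 0} => mk ℝ z.1 z.2) ⁻¹'
        {y | ∃ z hz, y = mk ℝ z hz ∧ z ∈ O}) = ⋃ a : ℝˣ, {z | a • z.1 ∈ O} := by
        ext ⟨z, hz⟩
        simp only [mem_preimage, mem_ofPred_eq, mem_iUnion]
        constructor
        · rintro ⟨z', hz', h1, h2⟩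
          obtain ⟨a, ha⟩ := (mk_eq_mk_iff ℝ _ _ hz' hz).mp h1.symm
          exact ⟨a, by rw [ha]; exact h2⟩
        · rintro ⟨a, ha⟩
          refine ⟨a • z, ?_, ?_, ha⟩
          · exact (smul_ne_zero_iff_ne a).mpr hz
          · exact (mk_eq_mk_iff ℝ _ _ _ _).mpr ⟨a⁻¹, by simp⟩
      rw [this]
      refine isOpen_iUnion fun a => ?_
      have hc : Continuous fun z : {v : Fin (p + q + 2) → ℝ // v ≠ 0} => a • z.1 := by
        simp only [Units.smul_def]; fun_prop
      exact hOo.preimage hc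
    exact key

end
section
variable {Ω : Set (ℙ ℝ (Fin (p + q + 2) → ℝ))}

lemma cone_open (hE : Ω ⊆ einSet (bForm p q))
    (hO : IsOpen (Subtype.val ⁻¹' Ω : Set (einSet (bForm p q))))
    {v : Fin (p + q + 2) → ℝ} (hv : v ≠ 0) (hvΩ : mk ℝ v hv ∈ Ω) :
    ∃ ε > 0, ∀ z, bForm p q z z = 0 → ‖z - v‖ < 5 * ε → ∃ h : z ≠ 0, mk ℝ z h ∈ Ω := by
  obtain ⟨U, hU, hUΩ⟩ := isOpen_induced_iff.mp hO
  have hUm : ∀ x ∈ einSet (bForm p q), x ∈ U ↔ x ∈ Ω := by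
    intro x hx
    have := Set.ext_iff.mp hUΩ ⟨x, hx⟩
    simpa using this
  have h1 : IsOpen ((fun z : {v : Fin (p + q + 2) → ℝ // v ≠ 0} => mk ℝ z.1 z.2) ⁻¹' U) := hU
  have hs : IsOpen {z : Fin (p + q + 2) → ℝ | z ≠ 0} := isOpen_ne
  have h2 := hs.isOpenMap_subtype_val _ h1
  obtain ⟨ε, hε, hb⟩ := Metric.isOpen_iff.mp h2 v
    ⟨⟨v, hv⟩, (hUm _ (hE hvΩ)).mpr hvΩ, rfl⟩
  refine ⟨ε / 5, by positivity, fun z hz hzv => ?_⟩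
  have : z ∈ Metric.ball v ε := by rw [mem_ball_iff_norm]; linarith
  obtain ⟨⟨z', hz'⟩, hm, rfl⟩ := hb this
  exact ⟨hz', (hUm _ ((mem_ein _ hz').mpr hz)).mp hm⟩

lemma Sl_self {ε : ℝ} (hε : 0 < ε) {v : Fin (p + q + 2) → ℝ} (hQ : bForm p q v v = 0) :
    Sl p q ε v v := ⟨hQ, rfl, by simpa using hε⟩

lemma local_chain_s10 (hp : 1 ≤ p) (hq : 1 ≤ q) (hE : Ω ⊆ einSet (bForm p q))
    (hO : IsOpen (Subtype.val ⁻¹' Ω : Set (einSet (bForm p q))))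
    {x : ℙ ℝ (Fin (p + q + 2) → ℝ)} (hx : x ∈ Ω) :
    Stp p q Ω x x ∧ ∀ᶠ y in 𝓝 x, y ∈ einSet (bForm p q) → Rk p q Ω 4 x y := by
  induction x using Projectivization.ind with
  | h v hv =>
    have hQ := (mem_ein v hv).mp (hE hx)
    obtain ⟨ε, hε, H⟩ := cone_open hE hO hv hx
    constructor
    · obtain ⟨z, hzv, hz, hvz⟩ := exists_other hp hq hv hQ hε
      obtain ⟨α, h1, h2, h3⟩ := geod hv H (Sl_self hε hQ) hz hvz hzv.symm hv (Sl_ne hv hz)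
      have h0 : (0 : ℝ) ∈ II := by simp [II]
      exact ⟨α, 0, 0, h1, h0, h0, h2, h2, by simp [dHyp]⟩
    · have step : ∀ {z0 z1} (hz0 : Sl p q ε v z0) (hz1 : Sl p q ε v z1)
          (_ : bForm p q z0 z1 = 0), Rk p q Ω 1 (mk ℝ z0 (Sl_ne hv hz0)) (mk ℝ z1 (Sl_ne hv hz1)) := by
        intro z0 z1 hz0 hz1 h01
        by_cases hne : z0 = z1
        · subst hne
          exact ⟨0, by omega, Ch.refl _⟩
        · obtain ⟨α, h1, h2, h3⟩ := geod hv H hz0 hz1 h01 hne (Sl_ne hv hz0) (Sl_ne hv hz1)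
          refine ⟨1, le_rfl, Ch.snoc (Ch.refl _) ⟨α, 0, 1 / 2, h1, ?_, ?_, h2, h3, dHyp_half⟩⟩
          · simp [II]
          · simp only [II, mem_Ioo]; norm_num
      filter_upwards [near_proj hv (local_vec hp hq hv hQ hε)] with y hy hyE
      obtain ⟨z, hz, rfl, hP⟩ := hy
      obtain ⟨c, z1, z2, z3, hc, s1, s2, s3, s4, b1, b2, b3, b4⟩ := hP ((mem_ein z hz).mp hyE)
      have := (((step (Sl_self hε hQ) s1 b1).trans (step s1 s2 b2)).trans (step s2 s3 b3)).trans
        (step s3 s4 b4)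
      have he : mk ℝ (c • z) (Sl_ne hv s4) = mk ℝ z hz :=
        (mk_eq_mk_iff' ℝ _ _ _ _).mpr ⟨c, rfl⟩
      rw [he] at this
      exact this
end

end Aux

/-- Uniform bound on the bounded-index Markowitz pseudodistance on
compact subsets of a proper dually convex domain. -/
theorem stmt_10 (p q : ℕ) (hp : 1 ≤ p) (hq : 1 ≤ q)
    (Ω : Set (ℙ ℝ (Fin (p + q + 2) → ℝ)))
    (hΩ : IsProperDomain (bForm p q) Ω)
    (hdc : IsDuallyConvex (bForm p q) Ω)
    (𝒦 : Set (ℙ ℝ (Fin (p + q + 2) → ℝ))) (h𝒦 : 𝒦 ⊆ Ω) (h𝒦c : IsCompact 𝒦) :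
    ∃ N : ℕ, 1 ≤ N ∧ ∃ M : ℝ, 0 < M ∧
      ∀ x ∈ 𝒦, ∀ y ∈ 𝒦, markowitzN (bForm p q) Ω N x y ≤ ENNReal.ofReal M := by
  obtain ⟨⟨hE, hO, hne, hconn⟩, -⟩ := hΩ
  obtain ⟨⟨x0, hx0E⟩, hx0⟩ := hne
  have hx0 : x0 ∈ Ω := hx0
  have hreach : ∀ y ∈ Ω, ∃ k, Rk p q Ω k x0 y := by
    intro y hy
    refine IsPreconnected.induction₂ hconn (fun a b => ∃ k, Rk p q Ω k a.1 b.1) ?_ ?_ ?_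
      (x := ⟨x0, hx0E⟩) (y := ⟨y, hE hy⟩) hx0 hy
    · rintro ⟨a, haE⟩ ha
      have h := (local_chain_s10 hp hq hE hO (show a ∈ Ω from ha)).2
      have h2 := (continuous_subtype_val (p := (· ∈ einSet (bForm p q)))).tendsto ⟨a, haE⟩
      refine Filter.Eventually.filter_mono nhdsWithin_le_nhds ?_
      filter_upwards [h2.eventually h] with b hb
      exact ⟨4, hb b.2⟩
    · rintro a b c - - - ⟨k, hk⟩ ⟨l, hl⟩
      exact ⟨k + l, hk.trans hl⟩
    · rintro a b - - ⟨k, hk⟩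
      exact ⟨k, hk.symm⟩
  have hK : ∃ k, ∀ y ∈ 𝒦, y ∈ einSet (bForm p q) → Rk p q Ω k x0 y := by
    refine h𝒦c.induction_on (p := fun S => ∃ k, ∀ y ∈ S, y ∈ einSet (bForm p q) → Rk p q Ω k x0 y)
      ⟨0, by simp⟩ ?_ ?_ ?_
    · rintro s t hst ⟨k, hk⟩
      exact ⟨k, fun y hy => hk y (hst hy)⟩
    · rintro s t ⟨k, hk⟩ ⟨l, hl⟩
      refine ⟨max k l, fun y hy hyE => ?_⟩
      rcases hy with hy | hy
      · exact (hk y hy hyE).mono (le_max_left _ _)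
      · exact (hl y hy hyE).mono (le_max_right _ _)
    · intro x hx
      obtain ⟨k, hk⟩ := hreach x (h𝒦 hx)
      refine ⟨_, nhdsWithin_le_nhds (local_chain_s10 hp hq hE hO (h𝒦 hx)).2, k + 4, ?_⟩
      intro y hy hyE
      exact hk.trans (hy hyE)
  obtain ⟨k, hk⟩ := hK
  refine ⟨k + k + 1, by omega, 2 * ((k + k + 1 : ℕ) : ℝ), by positivity, fun x hx y hy => ?_⟩
  obtain ⟨n, hn, hch⟩ := (hk x hx (hE (h𝒦 hx))).symm.trans (hk y hy (hE (h𝒦 hy)))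
  obtain ⟨c, hc, hcc⟩ := (Ch.snoc hch (local_chain_s10 hp hq hE hO (h𝒦 hy)).1).cost
  unfold markowitzN
  refine le_trans (sInf_le (a := ENNReal.ofReal c) ⟨n + 1, c, by omega, by omega, hcc, rfl⟩) (ENNReal.ofReal_le_ofReal ?_)
  have : ((n + 1 : ℕ) : ℝ) ≤ ((k + k + 1 : ℕ) : ℝ) := by exact_mod_cast (by omega)
  linarith
end
end

section
/- Let p, q ≥ 1 and let Ω be a proper dually convex domain of Ein^{p,q}. Let a ∈ ∂Ω be photon-extremal and let N ≥ 1. For all sequences (x_k), (y_k) in Ω such that x_k → a in ℙ(ℝⁿ) and such that there is M > 0 with δ^Ω_N(x_k, y_k) ≤ M for all k, one has y_k → a. -/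
noncomputable section

open scoped LinearAlgebra.Projectivization ENNReal
open Projectivization Filter Topology Set

variable {W : Type} [AddCommGroup W] [Module ℝ W] [TopologicalSpace W]

theorem real_step_pos (p r s t τ K : ℝ) (hp : 0 < p) (h1 : r ≤ p) (h2 : -p ≤ r)
    (hs : s ∈ II) (ht : t ∈ II) (hK : 0 < K)
    (hK1 : (1 + t) * (1 - s) ≤ K * ((1 - t) * (1 + s)))
    (hK2 : (1 - t) * (1 + s) ≤ K * ((1 + t) * (1 - s)))
    (hτ1 : -K⁻¹ < τ) (hτ2 : τ < 1) :
    ∃ κ ρ : ℝ, κ ≠ 0 ∧ ρ ∈ II ∧ κ = (1 - τ) / (p + s * r) + τ / (p + t * r) ∧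
      κ * ρ = (1 - τ) * s / (p + s * r) + τ * t / (p + t * r) := by
  obtain ⟨hs1, hs2⟩ := hs
  obtain ⟨ht1, ht2⟩ := ht
  have hφ : ∀ x : ℝ, -1 < x → x < 1 → 0 < p + x * r := by
    intro x hx1 hx2
    rcases le_total 0 r with h | h <;> nlinarith
  have hφs := hφ s hs1 hs2
  have hφt := hφ t ht1 ht2
  have hK1' : 1 ≤ K := by
    by_contra hlt
    push Not at hlt
    have A : 0 < (1 + t) * (1 - s) := mul_pos (by linarith) (by linarith)
    have B : 0 < (1 - t) * (1 + s) := mul_pos (by linarith) (by linarith)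
    nlinarith
  have hτK : -1 < τ * K := by
    have := mul_lt_mul_of_pos_right hτ1 hK
    rwa [neg_mul, inv_mul_cancel₀ hK.ne'] at this
  have e1 : (p + s * r) * (1 + t) ≤ K * ((p + t * r) * (1 + s)) := by
    have a1 : (p - r) * ((1 + t) * (1 - s)) ≤ (p - r) * (K * ((1 - t) * (1 + s))) :=
      mul_le_mul_of_nonneg_left hK1 (by linarith)
    have a2 : 0 ≤ (K - 1) * ((p + r) * ((1 + s) * (1 + t))) := by
      apply mul_nonneg (by linarith)
      apply mul_nonneg (by linarith)
      apply mul_nonneg <;> linarith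
    nlinarith
  have e2 : (p + s * r) * (1 - t) ≤ K * ((p + t * r) * (1 - s)) := by
    have a1 : (p + r) * ((1 - t) * (1 + s)) ≤ (p + r) * (K * ((1 + t) * (1 - s))) :=
      mul_le_mul_of_nonneg_left hK2 (by linarith)
    have a2 : 0 ≤ (K - 1) * ((p - r) * ((1 - s) * (1 - t))) := by
      apply mul_nonneg (by linarith)
      apply mul_nonneg (by linarith)
      apply mul_nonneg <;> linarith
    nlinarith
  have key : ∀ S T : ℝ, 0 < S → 0 < T → (p + s * r) * T ≤ K * ((p + t * r) * S) →
      0 < (1 - τ) * S / (p + s * r) + τ * T / (p + t * r) := by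
    intro S T hS hT h
    rw [div_add_div _ _ hφs.ne' hφt.ne']
    apply div_pos _ (mul_pos hφs hφt)
    have hP : 0 < (p + t * r) * S := mul_pos hφt hS
    have hQ : 0 < (p + s * r) * T := mul_pos hφs hT
    rcases le_or_gt 0 τ with h0 | h0
    · nlinarith [mul_nonneg h0 hQ.le, mul_pos (sub_pos.2 hτ2) hP]
    · have b1 : τ * (K * ((p + t * r) * S)) ≤ τ * ((p + s * r) * T) :=
        mul_le_mul_of_nonpos_left h h0.le
      have b2 : 0 < (1 + τ * K) * ((p + t * r) * S) := mul_pos (by linarith) hP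
      have b3 : 0 < (-τ) * ((p + t * r) * S) := mul_pos (by linarith) hP
      nlinarith
  have k1 := key (1 + s) (1 + t) (by linarith) (by linarith) e1
  have k2 := key (1 - s) (1 - t) (by linarith) (by linarith) e2
  set κ := (1 - τ) / (p + s * r) + τ / (p + t * r) with hκ
  set m := (1 - τ) * s / (p + s * r) + τ * t / (p + t * r) with hm
  have k1' : 0 < κ + m := by
    have : κ + m = (1 - τ) * (1 + s) / (p + s * r) + τ * (1 + t) / (p + t * r) := by
      rw [hκ, hm]; ring
    rwa [this]
  have k2' : 0 < κ - m := by
    have : κ - m = (1 - τ) * (1 - s) / (p + s * r) + τ * (1 - t) / (p + t * r) := by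
      rw [hκ, hm]; ring
    rwa [this]
  have hκ0 : 0 < κ := by linarith
  refine ⟨κ, m / κ, hκ0.ne', ⟨?_, ?_⟩, rfl, by field_simp⟩
  · rw [lt_div_iff₀ hκ0]; linarith
  · rw [div_lt_iff₀ hκ0]; linarith

theorem real_step (p r s t τ K : ℝ) (hne : ∀ x ∈ II, p + x * r ≠ 0)
    (hs : s ∈ II) (ht : t ∈ II) (hK : 0 < K)
    (hK1 : (1 + t) * (1 - s) ≤ K * ((1 - t) * (1 + s)))
    (hK2 : (1 - t) * (1 + s) ≤ K * ((1 + t) * (1 - s)))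
    (hτ1 : -K⁻¹ < τ) (hτ2 : τ < 1) :
    ∃ κ ρ : ℝ, κ ≠ 0 ∧ ρ ∈ II ∧ κ = (1 - τ) / (p + s * r) + τ / (p + t * r) ∧
      κ * ρ = (1 - τ) * s / (p + s * r) + τ * t / (p + t * r) := by
  have hp : p ≠ 0 := by
    have := hne 0 ⟨by norm_num, by norm_num⟩
    simpa using this
  have habs : |r| ≤ |p| := by
    by_contra hlt
    push Not at hlt
    have hr : r ≠ 0 := by
      rintro rfl
      simp at hlt
      exact absurd hlt (not_lt.2 (abs_nonneg p))
    have hr' : 0 < |r| := abs_pos.2 hr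
    have h1 : |-p / r| < 1 := by
      rw [abs_div, abs_neg, div_lt_one hr']; exact hlt
    apply hne (-p / r) (abs_lt.1 h1)
    field_simp
    ring
  rcases lt_or_gt_of_ne hp with h | h
  · rw [abs_of_neg h] at habs
    obtain ⟨κ, ρ, h1, h2, h3, h4⟩ := real_step_pos (-p) (-r) s t τ K (by linarith)
      (by linarith [neg_abs_le r]) (by linarith [le_abs_self r]) hs ht hK hK1 hK2 hτ1 hτ2
    have e : ∀ x : ℝ, -p + x * -r = -(p + x * r) := fun x => by ring
    rw [e, e, div_neg, div_neg] at h3 h4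
    exact ⟨-κ, ρ, neg_ne_zero.2 h1, h2, by linarith, by linarith⟩
  · rw [abs_of_pos h] at habs
    exact real_step_pos p r s t τ K h (by linarith [le_abs_self r])
      (by linarith [neg_abs_le r]) hs ht hK hK1 hK2 hτ1 hτ2

theorem dHyp_bounds (s t M : ℝ) (hs : s ∈ II) (ht : t ∈ II) (h : dHyp s t ≤ M) :
    (1 + t) * (1 - s) ≤ Real.exp M * ((1 - t) * (1 + s)) ∧
    (1 - t) * (1 + s) ≤ Real.exp M * ((1 + t) * (1 - s)) := by
  obtain ⟨hs1, hs2⟩ := hs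
  obtain ⟨ht1, ht2⟩ := ht
  have A : 0 < (1 + t) * (1 - s) := mul_pos (by linarith) (by linarith)
  have B : 0 < (1 - t) * (1 + s) := mul_pos (by linarith) (by linarith)
  obtain ⟨h1, h2⟩ := abs_le.1 h
  rw [Real.log_le_iff_le_exp (div_pos A B), div_le_iff₀ B] at h2
  rw [Real.le_log_iff_exp_le (div_pos A B), le_div_iff₀ B, Real.exp_neg] at h1
  refine ⟨h2, ?_⟩
  rwa [inv_mul_le_iff₀ (Real.exp_pos M)] at h1

variable {m : ℕ}

/-- Normalized representative of a point in the affine chart `f = 1`. -/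
def nrep (f : (Fin m → ℝ) →ₗ[ℝ] ℝ) (y : ℙ ℝ (Fin m → ℝ)) : Fin m → ℝ :=
  (f y.rep)⁻¹ • y.rep

/-- A globally continuous scaling-invariant vector valued map. -/
def hmap (f : (Fin m → ℝ) →ₗ[ℝ] ℝ) (y : ℙ ℝ (Fin m → ℝ)) : Fin m → ℝ :=
  (f y.rep / ‖y.rep‖ ^ 2) • y.rep

theorem hmap_mk (f : (Fin m → ℝ) →ₗ[ℝ] ℝ) (v : Fin m → ℝ) (hv : v ≠ 0) :
    hmap f (Projectivization.mk ℝ v hv) = (f v / ‖v‖ ^ 2) • v := by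
  obtain ⟨a, ha⟩ := Projectivization.exists_smul_eq_mk_rep ℝ v hv
  have ha' : (a : ℝ) • v = (Projectivization.mk ℝ v hv).rep := ha
  have h0 : (a : ℝ) ≠ 0 := a.ne_zero
  have hn : ‖v‖ ≠ 0 := norm_ne_zero_iff.2 hv
  unfold hmap
  rw [← ha', map_smul, norm_smul, smul_smul, mul_pow, Real.norm_eq_abs, sq_abs, smul_eq_mul]
  congr 1
  field_simp

theorem nrep_mk (f : (Fin m → ℝ) →ₗ[ℝ] ℝ) (v : Fin m → ℝ) (hv : v ≠ 0) :
    nrep f (Projectivization.mk ℝ v hv) = (f v)⁻¹ • v := by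
  obtain ⟨a, ha⟩ := Projectivization.exists_smul_eq_mk_rep ℝ v hv
  have ha' : (a : ℝ) • v = (Projectivization.mk ℝ v hv).rep := ha
  have h0 : (a : ℝ) ≠ 0 := a.ne_zero
  unfold nrep
  rw [← ha', map_smul, smul_smul, smul_eq_mul]
  congr 1
  rw [mul_inv, mul_comm, ← mul_assoc, mul_inv_cancel₀ h0, one_mul]

theorem continuous_pmk : Continuous
    (fun v : {v : Fin m → ℝ // v ≠ 0} => Projectivization.mk ℝ v.1 v.2) :=
  continuous_quotient_mk'

theorem continuous_of_comp_mk {Z : Type*} [TopologicalSpace Z] {g : ℙ ℝ (Fin m → ℝ) → Z}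
    (h : Continuous (fun v : {v : Fin m → ℝ // v ≠ 0} => g (Projectivization.mk ℝ v.1 v.2))) :
    Continuous g :=
  isQuotientMap_quotient_mk'.continuous_iff.2 h

theorem continuous_hmap (f : (Fin m → ℝ) →ₗ[ℝ] ℝ) : Continuous (hmap f) := by
  apply continuous_of_comp_mk
  simp_rw [hmap_mk]
  have hf : Continuous f := LinearMap.continuous_of_finiteDimensional f
  refine Continuous.smul (Continuous.div (hf.comp continuous_subtype_val) (by fun_prop) ?_)
    continuous_subtype_val
  intro v
  exact pow_ne_zero 2 (norm_ne_zero_iff.2 v.2)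

theorem nrep_eq_hmap (f : (Fin m → ℝ) →ₗ[ℝ] ℝ) (y : ℙ ℝ (Fin m → ℝ)) (hy : f y.rep ≠ 0) :
    nrep f y = (f (hmap f y))⁻¹ • hmap f y := by
  have hn : ‖y.rep‖ ≠ 0 := norm_ne_zero_iff.2 y.rep_nonzero
  unfold nrep hmap
  rw [map_smul, smul_smul, smul_eq_mul]
  congr 1
  field_simp

theorem f_hmap (f : (Fin m → ℝ) →ₗ[ℝ] ℝ) (y : ℙ ℝ (Fin m → ℝ)) :
    f (hmap f y) = (f y.rep) ^ 2 / ‖y.rep‖ ^ 2 := by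
  unfold hmap
  rw [map_smul, smul_eq_mul]; ring

theorem f_hmap_ne (f : (Fin m → ℝ) →ₗ[ℝ] ℝ) (y : ℙ ℝ (Fin m → ℝ)) :
    0 < f (hmap f y) ↔ f y.rep ≠ 0 := by
  have hn : 0 < ‖y.rep‖ := norm_pos_iff.2 y.rep_nonzero
  rw [f_hmap]
  constructor
  · rintro h h0
    simp [h0] at h
  · intro h
    positivity

theorem f_nrep (f : (Fin m → ℝ) →ₗ[ℝ] ℝ) (y : ℙ ℝ (Fin m → ℝ)) (hy : f y.rep ≠ 0) :
    f (nrep f y) = 1 := by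
  unfold nrep
  rw [map_smul, smul_eq_mul, inv_mul_cancel₀ hy]

theorem tendsto_nrep {ι : Type*} (F : Filter ι) (f : (Fin m → ℝ) →ₗ[ℝ] ℝ)
    (x : ι → ℙ ℝ (Fin m → ℝ)) (a : ℙ ℝ (Fin m → ℝ)) (h : Tendsto x F (𝓝 a))
    (ha : f a.rep ≠ 0) (hx : ∀ k, f (x k).rep ≠ 0) :
    Tendsto (fun k => nrep f (x k)) F (𝓝 (nrep f a)) := by
  have hf : Continuous f := LinearMap.continuous_of_finiteDimensional f
  have h1 : Tendsto (fun k => hmap f (x k)) F (𝓝 (hmap f a)) :=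
    ((continuous_hmap f).tendsto a).comp h
  have h2 : Tendsto (fun k => f (hmap f (x k))) F (𝓝 (f (hmap f a))) :=
    (hf.tendsto _).comp h1
  simp_rw [fun k => nrep_eq_hmap f (x k) (hx k), nrep_eq_hmap f a ha]
  exact (h2.inv₀ ((f_hmap_ne f a).2 ha).ne').smul h1

theorem mk_smul_eq (v : Fin m → ℝ) (c : ℝ) (hv : v ≠ 0) (hc : c ≠ 0) (h : c • v ≠ 0) :
    Projectivization.mk ℝ (c • v) h = Projectivization.mk ℝ v hv := by
  rw [Projectivization.mk_eq_mk_iff']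
  exact ⟨c, rfl⟩

theorem mk_nrep (f : (Fin m → ℝ) →ₗ[ℝ] ℝ) (y : ℙ ℝ (Fin m → ℝ)) (hy : f y.rep ≠ 0)
    (h : nrep f y ≠ 0) : Projectivization.mk ℝ (nrep f y) h = y := by
  conv_rhs => rw [← y.mk_rep]
  exact mk_smul_eq _ _ _ (inv_ne_zero hy) h

instance compact_proj : CompactSpace (ℙ ℝ (Fin m → ℝ)) := by
  let g : Metric.sphere (0 : Fin m → ℝ) 1 → ℙ ℝ (Fin m → ℝ) :=
    fun v => Projectivization.mk ℝ v.1 (by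
      intro h
      have := v.2
      simp [h] at this)
  have hg : Continuous g := by
    have : Continuous (fun v : Metric.sphere (0 : Fin m → ℝ) 1 =>
        (⟨v.1, by
          intro h
          have := v.2
          simp [h] at this⟩ : {v : Fin m → ℝ // v ≠ 0})) := by fun_prop
    exact continuous_pmk.comp this
  have hs : Function.Surjective g := by
    intro y
    have hn : ‖y.rep‖ ≠ 0 := norm_ne_zero_iff.2 y.rep_nonzero
    refine ⟨⟨‖y.rep‖⁻¹ • y.rep, ?_⟩, ?_⟩
    · simp [norm_smul, hn]
    · conv_rhs => rw [← y.mk_rep]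
      exact mk_smul_eq _ _ _ (inv_ne_zero hn) _
  rw [← isCompact_univ_iff, ← hs.range_eq]
  exact isCompact_range hg

/-- One step along a lightlike geodesic extends uniformly past the starting point. -/
theorem geod_step (Bf : (Fin m → ℝ) → (Fin m → ℝ) → ℝ) (Ω : Set (ℙ ℝ (Fin m → ℝ)))
    (f : (Fin m → ℝ) →ₗ[ℝ] ℝ) (hf : ∀ y ∈ Ω, f y.rep ≠ 0) (α : ℝ → ℙ ℝ (Fin m → ℝ))
    (hα : IsLightGeodesic Bf Ω α) (s t M τ : ℝ) (hs : s ∈ II) (ht : t ∈ II)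
    (hM : dHyp s t ≤ M) (hτ1 : -(Real.exp M)⁻¹ < τ) (hτ2 : τ < 1) :
    ∃ h : nrep f (α s) + τ • (nrep f (α t) - nrep f (α s)) ≠ 0,
      Projectivization.mk ℝ _ h ∈ Ω := by
  obtain ⟨u, w, a, b, c, d, -, -, -, -, -, H⟩ := hα
  have hφ : ∀ x, f ((a * x + b) • u + (c * x + d) • w) =
      (b * f u + d * f w) + x * (a * f u + c * f w) := by
    intro x
    simp only [map_add, map_smul, smul_eq_mul]; ring
  have hne : ∀ x ∈ II, (b * f u + d * f w) + x * (a * f u + c * f w) ≠ 0 := by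
    intro x hx h0
    obtain ⟨h, e, hm⟩ := H x hx
    have h1 := f_nrep f _ (hf _ hm)
    rw [e, nrep_mk, map_smul, hφ, h0] at h1
    simp at h1
  obtain ⟨k1, k2⟩ := dHyp_bounds s t M hs ht hM
  obtain ⟨κ, ρ, h1, h2, h3, h4⟩ := real_step _ _ s t τ _ hne hs ht (Real.exp_pos M) k1 k2 hτ1 hτ2
  obtain ⟨hs0, es, -⟩ := H s hs
  obtain ⟨ht0, et, -⟩ := H t ht
  obtain ⟨hr0, er, hrm⟩ := H ρ h2
  have E : nrep f (α s) + τ • (nrep f (α t) - nrep f (α s)) =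
      κ • ((a * ρ + b) • u + (c * ρ + d) • w) := by
    rw [es, et, nrep_mk, nrep_mk, hφ, hφ]
    set A := (b * f u + d * f w) + s * (a * f u + c * f w)
    set B := (b * f u + d * f w) + t * (a * f u + c * f w)
    have e1 : κ * (a * ρ + b) = (1 - τ) / A * (a * s + b) + τ / B * (a * t + b) := by
      calc κ * (a * ρ + b) = a * (κ * ρ) + b * κ := by ring
        _ = _ := by rw [h4, h3]; ring
    have e2 : κ * (c * ρ + d) = (1 - τ) / A * (c * s + d) + τ / B * (c * t + d) := by
      calc κ * (c * ρ + d) = c * (κ * ρ) + d * κ := by ring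
        _ = _ := by rw [h4, h3]; ring
    rw [smul_add κ, smul_smul κ, smul_smul κ, e1, e2]
    module
  have hz : κ • ((a * ρ + b) • u + (c * ρ + d) • w) ≠ 0 := smul_ne_zero h1 hr0
  refine ⟨by rw [E]; exact hz, ?_⟩
  simp_rw [E]
  rw [mk_smul_eq _ _ hr0 h1, ← er]
  exact hrm

theorem mk_mem_closure {ι : Type*} (F : Filter ι) [F.NeBot] (Ω : Set (ℙ ℝ (Fin m → ℝ)))
    (Z : ι → Fin m → ℝ) (z : Fin m → ℝ) (hz : z ≠ 0) (h : Tendsto Z F (𝓝 z))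
    (hZ : ∀ k, ∃ h : Z k ≠ 0, Projectivization.mk ℝ (Z k) h ∈ Ω) :
    Projectivization.mk ℝ z hz ∈ closure Ω := by
  choose h0 hm using hZ
  have h1 : Tendsto (fun k => (⟨Z k, h0 k⟩ : {v : Fin m → ℝ // v ≠ 0})) F (𝓝 ⟨z, hz⟩) :=
    tendsto_subtype_rng.2 h
  have h2 := (continuous_pmk.tendsto (⟨z, hz⟩ : {v : Fin m → ℝ // v ≠ 0})).comp h1
  exact mem_closure_of_tendsto h2 (Eventually.of_forall hm)

/-- The form as a bilinear map. -/
def bLin (p q : ℕ) : (Fin (p + q + 2) → ℝ) →ₗ[ℝ] (Fin (p + q + 2) → ℝ) →ₗ[ℝ] ℝ :=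
  LinearMap.mk₂ ℝ (bForm p q)
    (by intro x y z; simp only [bForm, Pi.add_apply, ← Finset.sum_add_distrib]
        exact Finset.sum_congr rfl fun i _ => by ring)
    (by intro c x y; simp only [bForm, Pi.smul_apply, smul_eq_mul, Finset.mul_sum]
        exact Finset.sum_congr rfl fun i _ => by ring)
    (by intro x y z; simp only [bForm, Pi.add_apply, ← Finset.sum_add_distrib]
        exact Finset.sum_congr rfl fun i _ => by ring)
    (by intro c x y; simp only [bForm, Pi.smul_apply, smul_eq_mul, Finset.mul_sum]
        exact Finset.sum_congr rfl fun i _ => by ring)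

theorem bLin_apply (p q : ℕ) (v w : Fin (p + q + 2) → ℝ) : bLin p q v w = bForm p q v w := rfl

theorem bForm_comm (p q : ℕ) (v w : Fin (p + q + 2) → ℝ) : bForm p q v w = bForm p q w v :=
  Finset.sum_congr rfl fun i _ => by ring

theorem bForm_cont (p q : ℕ) :
    Continuous (fun x : (Fin (p + q + 2) → ℝ) × (Fin (p + q + 2) → ℝ) => bForm p q x.1 x.2) := by
  unfold bForm
  fun_prop

theorem isClosed_ein (p q : ℕ) : IsClosed (einSet (bForm p q)) := by
  have hc : Continuous (fun y : ℙ ℝ (Fin (p + q + 2) → ℝ) =>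
      bForm p q y.rep y.rep / ‖y.rep‖ ^ 2) := by
    apply continuous_of_comp_mk
    have : ∀ v : {v : Fin (p + q + 2) → ℝ // v ≠ 0},
        bForm p q (Projectivization.mk ℝ v.1 v.2).rep (Projectivization.mk ℝ v.1 v.2).rep /
          ‖(Projectivization.mk ℝ v.1 v.2).rep‖ ^ 2 = bForm p q v.1 v.1 / ‖v.1‖ ^ 2 := by
      rintro ⟨v, hv⟩
      obtain ⟨a, ha⟩ := Projectivization.exists_smul_eq_mk_rep ℝ v hv
      have ha' : (a : ℝ) • v = (Projectivization.mk ℝ v hv).rep := ha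
      have h0 : (a : ℝ) ≠ 0 := a.ne_zero
      have hn : ‖v‖ ≠ 0 := norm_ne_zero_iff.2 hv
      simp only
      rw [← ha', ← bLin_apply, ← bLin_apply, map_smul, map_smul, LinearMap.smul_apply, norm_smul,
        mul_pow, Real.norm_eq_abs, sq_abs, smul_eq_mul, smul_eq_mul]
      field_simp
    simp_rw [this]
    refine Continuous.div ?_ (by fun_prop) ?_
    · exact (bForm_cont p q).comp (continuous_subtype_val.prodMk continuous_subtype_val)
    · intro v
      exact pow_ne_zero 2 (norm_ne_zero_iff.2 v.2)
  have : einSet (bForm p q) = (fun y : ℙ ℝ (Fin (p + q + 2) → ℝ) =>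
      bForm p q y.rep y.rep / ‖y.rep‖ ^ 2) ⁻¹' {0} := by
    ext y
    have hn : ‖y.rep‖ ≠ 0 := norm_ne_zero_iff.2 y.rep_nonzero
    simp [einSet, hn, -norm_eq_zero, y.rep_nonzero]
  rw [this]
  exact isClosed_singleton.preimage hc

theorem geod_isotropic (p q : ℕ) (Ω : Set (ℙ ℝ (Fin (p + q + 2) → ℝ)))
    (f : (Fin (p + q + 2) → ℝ) →ₗ[ℝ] ℝ) (α : ℝ → ℙ ℝ (Fin (p + q + 2) → ℝ))
    (hα : IsLightGeodesic (bForm p q) Ω α) (s t : ℝ) (hs : s ∈ II) (ht : t ∈ II) :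
    bForm p q (nrep f (α s)) (nrep f (α t)) = 0 := by
  obtain ⟨u, w, a, b, c, d, -, h1, h2, h3, -, H⟩ := hα
  obtain ⟨hs0, es, -⟩ := H s hs
  obtain ⟨ht0, et, -⟩ := H t ht
  have h4 : bForm p q w u = 0 := by rw [bForm_comm]; exact h2
  rw [← bLin_apply] at h1 h2 h3 h4 ⊢
  rw [es, et, nrep_mk, nrep_mk]
  simp [h1, h2, h3, h4]

/-- The one-step attraction property. -/
theorem one_step (p q : ℕ) (Ω : Set (ℙ ℝ (Fin (p + q + 2) → ℝ)))
    (f : (Fin (p + q + 2) → ℝ) →ₗ[ℝ] ℝ) (hf : ∀ y ∈ closure Ω, f y.rep ≠ 0)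
    (a : ℙ ℝ (Fin (p + q + 2) → ℝ)) (ha : IsPhotonExtremal (bForm p q) Ω a) (M : ℝ)
    (x y : ℕ → ℙ ℝ (Fin (p + q + 2) → ℝ)) (hxa : Tendsto x atTop (𝓝 a))
    (hst : ∀ k, x k = y k ∨ ∃ α s t, IsLightGeodesic (bForm p q) Ω α ∧ s ∈ II ∧ t ∈ II ∧
      α s = x k ∧ α t = y k ∧ dHyp s t ≤ M)
    (hxΩ : ∀ k, x k ∈ Ω) (hyΩ : ∀ k, y k ∈ Ω) (hein : Ω ⊆ einSet (bForm p q)) :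
    Tendsto y atTop (𝓝 a) := by
  rw [tendsto_iff_ultrafilter]
  intro F hF
  have hxF : Tendsto x F (𝓝 a) := hxa.mono_left hF
  obtain ⟨b, -, hb⟩ := isCompact_univ.ultrafilter_le_nhds (F.map y) (by simp)
  have hyF : Tendsto y F (𝓝 b) := hb
  have hbΩ : b ∈ closure Ω := mem_closure_of_tendsto hyF (Eventually.of_forall hyΩ)
  have haΩ : a ∈ closure Ω := ha.1.1
  by_cases hab : b = a
  · rwa [hab] at hyF
  exfalso
  have hfx : ∀ k, f (x k).rep ≠ 0 := fun k => hf _ (subset_closure (hxΩ k))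
  have hfy : ∀ k, f (y k).rep ≠ 0 := fun k => hf _ (subset_closure (hyΩ k))
  have hfa := hf a haΩ
  have hfb := hf b hbΩ
  have hX := tendsto_nrep F f x a hxF hfa hfx
  have hY := tendsto_nrep F f y b hyF hfb hfy
  have hE : ∀ z ∈ Ω, bForm p q (nrep f z) (nrep f z) = 0 := by
    intro z hz
    have := hein hz
    have h0 : bForm p q z.rep z.rep = 0 := this
    rw [← bLin_apply] at h0 ⊢
    simp [nrep, h0]
  have hiso : ∀ k, bForm p q (nrep f (x k)) (nrep f (y k)) = 0 := by
    intro k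
    rcases hst k with h | ⟨α, s, t, hα, hs, ht, e1, e2, -⟩
    · rw [← h]; exact hE _ (hxΩ k)
    · rw [← e1, ← e2]; exact geod_isotropic p q Ω f α hα s t hs ht
  have hfA := f_nrep f a hfa
  have hfB := f_nrep f b hfb
  have hA0 : nrep f a ≠ 0 := by
    intro h; rw [h, map_zero] at hfA; exact zero_ne_one hfA
  have hB0 : nrep f b ≠ 0 := by
    intro h; rw [h, map_zero] at hfB; exact zero_ne_one hfB
  have hmA := mk_nrep f a hfa hA0
  have hmB := mk_nrep f b hfb hB0
  set A := nrep f a with hA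
  set B := nrep f b with hB
  have lim : ∀ (P Q : ℕ → Fin (p + q + 2) → ℝ) (P' Q' : Fin (p + q + 2) → ℝ),
      Tendsto P F (𝓝 P') → Tendsto Q F (𝓝 Q') → (∀ k, bForm p q (P k) (Q k) = 0) →
      bForm p q P' Q' = 0 := by
    intro P Q P' Q' hP hQ h0
    have h1 := ((bForm_cont p q).tendsto (P', Q')).comp (hP.prodMk_nhds hQ)
    have h2 : (fun x : (Fin (p + q + 2) → ℝ) × (Fin (p + q + 2) → ℝ) => bForm p q x.1 x.2) ∘
      (fun k => (P k, Q k)) = fun _ => 0 := by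
      funext k; exact h0 k
    rw [h2] at h1
    exact tendsto_nhds_unique h1 tendsto_const_nhds
  have iAA : bForm p q A A = 0 := lim _ _ _ _ hX hX (fun k => hE _ (hxΩ k))
  have iAB : bForm p q A B = 0 := lim _ _ _ _ hX hY hiso
  have iBB : bForm p q B B = 0 := lim _ _ _ _ hY hY (fun k => hE _ (hyΩ k))
  have iBA : bForm p q B A = 0 := by rw [bForm_comm]; exact iAB
  have hABne : A ≠ B := by
    intro h
    apply hab
    calc b = Projectivization.mk ℝ B hB0 := hmB.symm
      _ = Projectivization.mk ℝ A hA0 :=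
        (Projectivization.mk_eq_mk_iff' ℝ _ _ _ _).2 ⟨1, by rw [one_smul, h]⟩
      _ = a := hmA
  have hli : LinearIndependent ℝ ![A, B] := by
    rw [LinearIndependent.pair_iff]
    intro c d h
    have h1 : c + d = 0 := by
      have := congrArg f h
      simpa [hfA, hfB] using this
    have h2 : d • (B - A) = 0 := by
      have : c = -d := by linarith
      rw [this] at h
      rw [← h]; module
    rcases smul_eq_zero.1 h2 with h3 | h3
    · exact ⟨by linarith, h3⟩
    · exact absurd (sub_eq_zero.1 h3).symm hABne
  -- a functional vanishing at `A` and equal to one at `B`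
  obtain ⟨g, hgA, hgB⟩ : ∃ g : (Fin (p + q + 2) → ℝ) →ₗ[ℝ] ℝ, g A = 0 ∧ g B = 1 := by
    obtain ⟨i, hi⟩ := Function.ne_iff.1 hABne
    have hi' : B i - A i ≠ 0 := sub_ne_zero.2 (Ne.symm hi)
    refine ⟨(B i - A i)⁻¹ • (LinearMap.proj i - (A i) • f), ?_, ?_⟩
    · simp [hfA]
    · simp [hfB, hi']
  have hpts : ∀ τ : ℝ, -(Real.exp M)⁻¹ < τ → τ < 1 → ∀ h : A + τ • (B - A) ≠ 0,
      Projectivization.mk ℝ _ h ∈ closure Ω := by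
    intro τ h1 h2 h
    refine mk_mem_closure (F : Filter ℕ) Ω
      (fun k => nrep f (x k) + τ • (nrep f (y k) - nrep f (x k))) _ h ?_ ?_
    · exact hX.add ((hY.sub hX).const_smul τ)
    · intro k
      rcases hst k with h | ⟨α, s, t, hα, hs, ht, e1, e2, hM⟩
      · have e : nrep f (x k) + τ • (nrep f (y k) - nrep f (x k)) = nrep f (x k) := by
          rw [← h]; module
        simp only [e]
        have h0 : nrep f (x k) ≠ 0 := by
          intro h0
          have := f_nrep f (x k) (hfx k)
          rw [h0, map_zero] at this
          exact zero_ne_one this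
        exact ⟨h0, by rw [mk_nrep f _ (hfx k)]; exact hxΩ k⟩
      · rw [← e1, ← e2]
        exact geod_step (bForm p q) Ω f (fun z hz => hf z (subset_closure hz)) α hα s t M τ
          hs ht hM h1 h2
  apply ha.2 (Submodule.span ℝ {A, B})
  · refine ⟨?_, ?_⟩
    · have := finrank_span_eq_card hli
      rw [Matrix.range_cons_cons_empty] at this
      simpa using this
    · intro u hu w hw
      obtain ⟨c, d, rfl⟩ := Submodule.mem_span_pair.1 hu
      obtain ⟨c', d', rfl⟩ := Submodule.mem_span_pair.1 hw
      rw [← bLin_apply] at iAA iAB iBB iBA ⊢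
      simp [iAA, iAB, iBB, iBA]
  · have : a.rep = (f a.rep) • A := by
      rw [hA, nrep, smul_smul, mul_inv_cancel₀ hfa, one_smul]
    rw [this]
    exact Submodule.smul_mem _ _ (Submodule.subset_span (by simp))
  have hfc : Continuous f := LinearMap.continuous_of_finiteDimensional f
  have hgc : Continuous g := LinearMap.continuous_of_finiteDimensional g
  have cf : Continuous (fun z => f (hmap f z)) := hfc.comp (continuous_hmap f)
  have cg : Continuous (fun z => g (hmap f z)) := hgc.comp (continuous_hmap f)
  have hfn : ∀ z, f z.rep ≠ 0 → g (nrep f z) = (f (hmap f z))⁻¹ * g (hmap f z) := by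
    intro z hz
    rw [nrep_eq_hmap f z hz, map_smul, smul_eq_mul]
  refine ⟨{z | 0 < f (hmap f z)} ∩ ({z | -(Real.exp M)⁻¹ * f (hmap f z) < g (hmap f z)} ∩
    {z | g (hmap f z) < f (hmap f z)}), ?_, ?_, ?_⟩
  · exact (isOpen_lt continuous_const cf).inter
      ((isOpen_lt (continuous_const.mul cf) cg).inter (isOpen_lt cg cf))
  · have h1 : 0 < f (hmap f a) := (f_hmap_ne f a).2 hfa
    have h2 := hfn a hfa
    rw [← hA, hgA] at h2
    have h3 : g (hmap f a) = 0 := by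
      rcases mul_eq_zero.1 h2.symm with h | h
      · exact absurd h (inv_ne_zero h1.ne')
      · exact h
    refine ⟨h1, ?_, ?_⟩
    · simp only [Set.mem_ofPred_eq, h3]
      have := mul_pos (inv_pos.2 (Real.exp_pos M)) h1
      linarith
    · simp only [Set.mem_ofPred_eq, h3]; exact h1
  · rintro z ⟨⟨h1, h2, h3⟩, hz⟩
    simp only [Set.mem_ofPred_eq] at h1 h2 h3
    have hfz := (f_hmap_ne f z).1 h1
    have hg := hfn z hfz
    have hz' : nrep f z ∈ Submodule.span ℝ {A, B} := Submodule.smul_mem _ _ hz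
    obtain ⟨c, d, hcd⟩ := Submodule.mem_span_pair.1 hz'
    have hfz1 := f_nrep f z hfz
    have e1 : c + d = 1 := by
      rw [← hcd] at hfz1
      simpa [hfA, hfB] using hfz1
    have e2 : g (nrep f z) = d := by
      rw [← hcd]; simp [hgA, hgB]
    have e3 : nrep f z = A + d • (B - A) := by
      have : c = 1 - d := by linarith
      rw [← hcd, this]; module
    have hz0 : nrep f z ≠ 0 := by
      intro h; rw [h, map_zero] at hfz1; exact zero_ne_one hfz1
    have e4 : d = g (hmap f z) / f (hmap f z) := by
      rw [← e2, hg]; ring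
    rw [← mk_nrep f z hfz hz0]
    have := hpts d (by rw [e4, lt_div_iff₀ h1]; exact h2) (by rw [e4, div_lt_one h1]; exact h3)
      (by rw [← e3]; exact hz0)
    simpa only [e3] using this

/-- Attraction at photon-extremal points for bounded-index chains in a
proper dually convex domain. -/
theorem stmt_11 (p q : ℕ) (hp : 1 ≤ p) (hq : 1 ≤ q)
    (Ω : Set (ℙ ℝ (Fin (p + q + 2) → ℝ)))
    (hΩ : IsProperDomain (bForm p q) Ω)
    (hdc : IsDuallyConvex (bForm p q) Ω)
    (a : ℙ ℝ (Fin (p + q + 2) → ℝ)) (ha : IsPhotonExtremal (bForm p q) Ω a)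
    (N : ℕ) (hN : 1 ≤ N)
    (xs ys : ℕ → ℙ ℝ (Fin (p + q + 2) → ℝ))
    (hxs : ∀ k, xs k ∈ Ω) (hys : ∀ k, ys k ∈ Ω)
    (hxa : Tendsto xs atTop (𝓝 a))
    (M : ℝ) (hM : 0 < M)
    (hbd : ∀ k, markowitzN (bForm p q) Ω N (xs k) (ys k) ≤ ENNReal.ofReal M) :
    Tendsto ys atTop (𝓝 a) := by
  obtain ⟨⟨hein, -, -⟩, x₀, -, hx0⟩ := hΩ
  have hcl : closure Ω ⊆ einSet (bForm p q) := closure_minimal hein (isClosed_ein p q)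
  have hf : ∀ y ∈ closure Ω, bLin p q x₀.rep y.rep ≠ 0 := by
    intro y hy h
    have : y ∈ closure Ω ∩ lightcone (bForm p q) x₀ := ⟨hy, hcl hy, h⟩
    rw [hx0] at this
    exact this
  -- a family of chains with cost at most `M + 1`
  have hch : ∀ k, ∃ (n : ℕ) (c : ℝ), n ≤ N ∧ IsChainCost (bForm p q) Ω (xs k) (ys k) n c ∧
      c ≤ M + 1 := by
    intro k
    have h1 : markowitzN (bForm p q) Ω N (xs k) (ys k) < ENNReal.ofReal (M + 1) :=
      lt_of_le_of_lt (hbd k) ((ENNReal.ofReal_lt_ofReal_iff (by linarith)).2 (by linarith))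
    obtain ⟨e, ⟨n, c, -, hn, hc, rfl⟩, he⟩ := sInf_lt_iff.1 h1
    exact ⟨n, c, hn, hc, ((ENNReal.ofReal_lt_ofReal_iff (by linarith)).1 he).le⟩
  have hz : ∀ k, ∃ z : ℕ → ℙ ℝ (Fin (p + q + 2) → ℝ), z 0 = xs k ∧ z N = ys k ∧
      ∀ i, z i ∈ Ω ∧ (z i = z (i + 1) ∨ ∃ α s t, IsLightGeodesic (bForm p q) Ω α ∧ s ∈ II ∧
        t ∈ II ∧ α s = z i ∧ α t = z (i + 1) ∧ dHyp s t ≤ M + 1) := by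
    intro k
    obtain ⟨n, c, hn, ⟨ps, αs, ss, ts, h0, hl, hi, hc⟩, hcM⟩ := hch k
    have hps : ∀ j : Fin (n + 1), ps j ∈ Ω := by
      intro j
      induction j using Fin.cases with
      | zero => rw [h0]; exact hxs k
      | succ j =>
        obtain ⟨hg, -, ht, -, e⟩ := hi j
        rw [← e]
        obtain ⟨u, w, a, b, c, d, -, -, -, -, -, H⟩ := hg
        exact (H _ ht).2.2
    refine ⟨fun i => ps ⟨min i n, by omega⟩, ?_, ?_, ?_⟩
    · rw [← h0]; exact congrArg ps (Fin.ext (by simp))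
    · rw [← hl]; exact congrArg ps (Fin.ext (by simp [hn]))
    · intro i
      refine ⟨hps _, ?_⟩
      by_cases hin : i < n
      · right
        obtain ⟨hg, hs, ht, e1, e2⟩ := hi ⟨i, hin⟩
        refine ⟨αs ⟨i, hin⟩, ss ⟨i, hin⟩, ts ⟨i, hin⟩, hg, hs, ht, ?_, ?_, ?_⟩
        · rw [e1]; exact congrArg ps (Fin.ext (by simp only [Fin.val_castSucc]; omega))
        · rw [e2]; exact congrArg ps (Fin.ext (by simp only [Fin.val_succ]; omega))
        · refine le_trans ?_ hcM
          rw [hc]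
          exact Finset.single_le_sum (f := fun i => dHyp (ss i) (ts i))
            (fun j _ => abs_nonneg _) (Finset.mem_univ (⟨i, hin⟩ : Fin n))
      · left
        exact congrArg ps (Fin.ext (by simp only; omega))
  choose z hz0 hzN hzi using hz
  have hmain : ∀ i : ℕ, Tendsto (fun k => z k i) atTop (𝓝 a) := by
    intro i
    induction i with
    | zero => simpa only [hz0] using hxa
    | succ i ih =>
      exact one_step p q Ω (bLin p q x₀.rep) hf a ha (M + 1) _ _ ih
        (fun k => (hzi k i).2) (fun k => (hzi k i).1) (fun k => (hzi k (i + 1)).1) hein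
  simpa only [hzN] using hmain N
end
end
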